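/- arXiv:1911.07282 — 3 statements merged into one kernel-verified Lean document; each statement's English description precedes it below -/
import Mathlib

section
/- Let n ≥ 2 be an integer, a > 0, c > a·log(2n−2), λ̄(φ) := −1/(c − a·log(2n−2−φ²)), and ψ(φ) := λ̄(φ)²·(1/a + C₁·(2n−2−φ²) + ((2n−2−φ²)/(4a(n−1)))·(log(φ²) − log(2n−2−φ²))) for a constant C₁ > 0. Then as φ ↘ 0: ψ/λ̄ = λ̄·((1/a)·log φ + 1/a + (2n−2)·C₁ − (1/(2a))·log(2n−2) + O(φ²·log(φ²))), ψ'/λ̄' = φ⁻²·((n−1)/a² + O(φ²·log(φ²))), and ψ''/λ̄'' = φ⁻²·(−(n−1)/a² + O(φ²·log(φ²))). Consequently, for δ > 0 sufficiently small there exists a constant M₃ such that |ψ|, |ψ/λ̄| ≤ M₃·(−log φ) and |ψ'/λ̄'|, |ψ''/λ̄''| ≤ M₃·φ⁻² for all 0 < φ ≤ δ. -/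
open Filter Topology Asymptotics

/-- `A(φ²) + B(φ²) φ² log φ²` equals `A(0)` up to `O(φ² log φ²)`. -/
lemma isBigO_add_sq_mul_log_sub {A B : ℝ → ℝ} (hA : DifferentiableAt ℝ A 0)
    (hB : ContinuousAt B 0) :
    (fun φ : ℝ => A (φ ^ 2) + B (φ ^ 2) * (φ ^ 2 * Real.log (φ ^ 2)) - A 0)
      =O[𝓝[>] 0] (fun φ : ℝ => φ ^ 2 * Real.log (φ ^ 2)) := by
  have hs : Tendsto (fun φ : ℝ => φ ^ 2) (𝓝[>] 0) (𝓝 0) :=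
    ((continuous_pow 2).tendsto' (0 : ℝ) 0 (by norm_num)).mono_left nhdsWithin_le_nhds
  have hlog : Tendsto (fun φ : ℝ => Real.log (φ ^ 2)) (𝓝[>] 0) atBot := by
    refine Real.tendsto_log_nhdsGT_zero.comp (tendsto_nhdsWithin_iff.2 ⟨hs, ?_⟩)
    filter_upwards [self_mem_nhdsWithin] with φ hφ
    exact pow_pos (Set.mem_Ioi.1 hφ) 2
  have hone : (fun φ : ℝ => φ ^ 2) =O[𝓝[>] 0] (fun φ : ℝ => φ ^ 2 * Real.log (φ ^ 2)) := by
    refine IsBigO.of_bound 1 ?_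
    filter_upwards [hlog.eventually_le_atBot (-1)] with φ hφ
    rw [norm_mul, one_mul]
    refine le_mul_of_one_le_right (norm_nonneg _) ?_
    rw [Real.norm_eq_abs, abs_of_nonpos (by linarith)]
    linarith
  have h1 : (fun φ : ℝ => A (φ ^ 2) - A 0) =O[𝓝[>] 0] (fun φ : ℝ => φ ^ 2) := by
    simpa [Function.comp_def] using hA.isBigO_sub.comp_tendsto hs
  have h2 : (fun φ : ℝ => B (φ ^ 2)) =O[𝓝[>] 0] (fun _ : ℝ => (1 : ℝ)) :=
    (hB.tendsto.comp hs).isBigO_one ℝ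
  have h3 := h2.mul (isBigO_refl (fun φ : ℝ => φ ^ 2 * Real.log (φ ^ 2)) (𝓝[>] 0))
  simp only [one_mul] at h3
  exact ((h1.trans hone).add h3).congr_left fun φ => by ring

lemma hasDerivAt_comp_sq {F : ℝ → ℝ} {φ : ℝ} (hF : DifferentiableAt ℝ F (φ ^ 2)) :
    HasDerivAt (fun x : ℝ => F (x ^ 2)) (deriv F (φ ^ 2) * (2 * φ)) φ := by
  exact (HasDerivAt.comp (h := fun x : ℝ => x ^ 2) φ hF.hasDerivAt
    (hasDerivAt_pow 2 φ)).congr_deriv (by norm_num)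

lemma hasDerivAt_log_sq {φ : ℝ} (hφ : φ ≠ 0) :
    HasDerivAt (fun x : ℝ => Real.log (x ^ 2)) (2 / φ) φ := by
  refine ((hasDerivAt_pow 2 φ).log (pow_ne_zero 2 hφ)).congr_deriv ?_
  norm_num
  field_simp

/-- First and second derivatives of `P(φ²) + Q(φ²) log φ²` for small `φ > 0`. -/
lemma eventually_deriv_add_mul_log {P Q f : ℝ → ℝ} (hP : AnalyticAt ℝ P 0)
    (hQ : AnalyticAt ℝ Q 0)
    (hf : f = fun φ => P (φ ^ 2) + Q (φ ^ 2) * Real.log (φ ^ 2)) :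
    ∀ᶠ φ : ℝ in 𝓝[>] 0,
      deriv f φ = 2 * φ * deriv P (φ ^ 2) + 2 * φ * deriv Q (φ ^ 2) * Real.log (φ ^ 2)
        + 2 * Q (φ ^ 2) / φ ∧
      deriv (deriv f) φ = 2 * deriv P (φ ^ 2) + 4 * φ ^ 2 * deriv (deriv P) (φ ^ 2)
        + (2 * deriv Q (φ ^ 2) + 4 * φ ^ 2 * deriv (deriv Q) (φ ^ 2)) * Real.log (φ ^ 2)
        + 8 * deriv Q (φ ^ 2) - 2 * Q (φ ^ 2) / φ ^ 2 := by
  have hs : Tendsto (fun φ : ℝ => φ ^ 2) (𝓝 0) (𝓝 0) :=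
    (continuous_pow 2).tendsto' (0 : ℝ) 0 (by norm_num)
  have hfirst : ∀ᶠ φ : ℝ in 𝓝 0, φ ≠ 0 →
      deriv f φ = 2 * φ * deriv P (φ ^ 2) + 2 * φ * deriv Q (φ ^ 2) * Real.log (φ ^ 2)
        + 2 * Q (φ ^ 2) / φ := by
    filter_upwards [hs.eventually hP.eventually_analyticAt,
      hs.eventually hQ.eventually_analyticAt] with φ hPφ hQφ hφ
    rw [hf]
    refine (((hasDerivAt_comp_sq hPφ.differentiableAt).add
      ((hasDerivAt_comp_sq hQφ.differentiableAt).mul (hasDerivAt_log_sq hφ))).congr_deriv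
      ?_).deriv
    ring
  have hsecond : ∀ᶠ φ : ℝ in 𝓝 0, φ ≠ 0 →
      deriv (deriv f) φ = 2 * deriv P (φ ^ 2) + 4 * φ ^ 2 * deriv (deriv P) (φ ^ 2)
        + (2 * deriv Q (φ ^ 2) + 4 * φ ^ 2 * deriv (deriv Q) (φ ^ 2)) * Real.log (φ ^ 2)
        + 8 * deriv Q (φ ^ 2) - 2 * Q (φ ^ 2) / φ ^ 2 := by
    filter_upwards [hfirst.eventually_nhds, hs.eventually hP.eventually_analyticAt,
      hs.eventually hQ.eventually_analyticAt] with φ hφ1 hPφ hQφ hφ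
    have hEq : deriv f =ᶠ[𝓝 φ] fun φ => 2 * φ * deriv P (φ ^ 2)
        + 2 * φ * deriv Q (φ ^ 2) * Real.log (φ ^ 2) + 2 * Q (φ ^ 2) / φ := by
      filter_upwards [hφ1, isOpen_ne.mem_nhds hφ] with x hx hx0 using hx hx0
    rw [hEq.deriv_eq]
    have hlin : HasDerivAt (fun x : ℝ => 2 * x) 2 φ := by
      simpa using (hasDerivAt_id φ).const_mul (2 : ℝ)
    refine ((((hlin.mul (hasDerivAt_comp_sq hPφ.deriv.differentiableAt)).add
      ((hlin.mul (hasDerivAt_comp_sq hQφ.deriv.differentiableAt)).mul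
        (hasDerivAt_log_sq hφ))).add
      (((hasDerivAt_comp_sq hQφ.differentiableAt).const_mul 2).div
        (hasDerivAt_id φ) hφ)).congr_deriv ?_).deriv
    simp only [id, Pi.mul_apply]
    field_simp
    ring
  filter_upwards [hfirst.filter_mono nhdsWithin_le_nhds,
    hsecond.filter_mono nhdsWithin_le_nhds, self_mem_nhdsWithin] with φ h1 h2 hφ
  exact ⟨h1 (ne_of_gt hφ), h2 (ne_of_gt hφ)⟩

/-- Quotients of the first and second derivatives of `P(φ²) + Q(φ²) log φ²` and `Λ(φ²)`. -/
lemma isBigO_deriv_div_deriv {P Q Λ f g : ℝ → ℝ} (hP : AnalyticAt ℝ P 0)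
    (hQ : AnalyticAt ℝ Q 0) (hΛ : AnalyticAt ℝ Λ 0) (hΛ0 : deriv Λ 0 ≠ 0)
    (hf : f = fun φ => P (φ ^ 2) + Q (φ ^ 2) * Real.log (φ ^ 2))
    (hg : g = fun φ => Λ (φ ^ 2)) :
    (fun φ : ℝ => φ ^ 2 * (deriv f φ / deriv g φ) - Q 0 / deriv Λ 0)
      =O[𝓝[>] 0] (fun φ : ℝ => φ ^ 2 * Real.log (φ ^ 2)) ∧
    (fun φ : ℝ => φ ^ 2 * (deriv (deriv f) φ / deriv (deriv g) φ) + Q 0 / deriv Λ 0)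
      =O[𝓝[>] 0] (fun φ : ℝ => φ ^ 2 * Real.log (φ ^ 2)) := by
  have hs : Tendsto (fun φ : ℝ => φ ^ 2) (𝓝[>] 0) (𝓝 0) :=
    ((continuous_pow 2).tendsto' (0 : ℝ) 0 (by norm_num)).mono_left nhdsWithin_le_nhds
  have hdf := eventually_deriv_add_mul_log hP hQ hf
  have hdg := eventually_deriv_add_mul_log (Q := fun _ => 0) (f := g) hΛ analyticAt_const
    (by simpa using hg)
  simp only [deriv_const', mul_zero, zero_mul, zero_div, add_zero, sub_zero] at hdg
  have hid : AnalyticAt ℝ (fun s : ℝ => s) 0 := analyticAt_id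
  have hP1 := hP.deriv
  have hP2 := hP1.deriv
  have hQ1 := hQ.deriv
  have hQ2 := hQ1.deriv
  have hΛ1 := hΛ.deriv
  have hΛ2 := hΛ1.deriv
  have hH : AnalyticAt ℝ (fun s => 2 * deriv Λ s + 4 * s * deriv (deriv Λ) s) 0 := by
    fun_prop
  have hH0 : 2 * deriv Λ 0 + 4 * 0 * deriv (deriv Λ) 0 ≠ 0 := by simpa using hΛ0
  constructor
  · have hA : AnalyticAt ℝ (fun s => (s * deriv P s + Q s) / deriv Λ s) 0 :=
      ((hid.mul hP1).add hQ).div hΛ1 hΛ0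
    have hB : AnalyticAt ℝ (fun s => deriv Q s / deriv Λ s) 0 := hQ1.div hΛ1 hΛ0
    refine (isBigO_add_sq_mul_log_sub hA.differentiableAt hB.continuousAt).congr' ?_ .rfl
    filter_upwards [hdf, hdg, self_mem_nhdsWithin,
      hs.eventually (hΛ1.continuousAt.eventually_ne hΛ0)] with φ h1 h2 hφ h3
    have hφ : φ ≠ 0 := ne_of_gt hφ
    rw [h1.1, h2.1]
    simp only [zero_mul, zero_add]
    field_simp
    ring
  · have hA : AnalyticAt ℝ (fun s => (2 * s * deriv P s + 4 * s ^ 2 * deriv (deriv P) s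
        + 8 * s * deriv Q s - 2 * Q s) / (2 * deriv Λ s + 4 * s * deriv (deriv Λ) s)) 0 := by
      refine AnalyticAt.div ?_ hH hH0
      fun_prop
    have hB : AnalyticAt ℝ (fun s => (2 * deriv Q s + 4 * s * deriv (deriv Q) s) /
        (2 * deriv Λ s + 4 * s * deriv (deriv Λ) s)) 0 := by
      refine AnalyticAt.div ?_ hH hH0
      fun_prop
    refine (isBigO_add_sq_mul_log_sub hA.differentiableAt hB.continuousAt).congr' ?_ .rfl
    filter_upwards [hdf, hdg, self_mem_nhdsWithin,
      hs.eventually (hH.continuousAt.eventually_ne hH0)] with φ h1 h2 hφ h3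
    have hφ : φ ≠ 0 := ne_of_gt hφ
    rw [h1.2, h2.2]
    have hval : (2 * 0 * deriv P 0 + 4 * 0 ^ 2 * deriv (deriv P) 0 + 8 * 0 * deriv Q 0
        - 2 * Q 0) / (2 * deriv Λ 0 + 4 * 0 * deriv (deriv Λ) 0) = - (Q 0 / deriv Λ 0) := by
      simp only [mul_zero, zero_mul, add_zero, zero_sub, ne_eq, OfNat.ofNat_ne_zero,
        not_false_eq_true, zero_pow]
      field_simp
    rw [hval]
    generalize 2 * deriv Λ (φ ^ 2) + 4 * φ ^ 2 * deriv (deriv Λ) (φ ^ 2) = H at h3 ⊢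
    rw [sub_neg_eq_add]
    congr 1
    field_simp
    ring

lemma tendsto_sq_mul_log_sq :
    Tendsto (fun φ : ℝ => φ ^ 2 * Real.log (φ ^ 2)) (𝓝[>] 0) (𝓝 0) := by
  have h := Real.continuous_mul_log.tendsto' 0 0 (by simp)
  exact h.comp (((continuous_pow 2).tendsto' (0 : ℝ) 0 (by norm_num)).mono_left
    nhdsWithin_le_nhds)

/-- If `φ² u(φ)` converges up to `O(φ² log φ²)`, then `u = O(φ⁻²)` near `0⁺`. -/
lemma exists_eventually_abs_le_mul_inv_sq {u : ℝ → ℝ} {k : ℝ}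
    (h : (fun φ : ℝ => φ ^ 2 * u φ - k) =O[𝓝[>] 0] (fun φ : ℝ => φ ^ 2 * Real.log (φ ^ 2))) :
    ∃ M : ℝ, ∀ᶠ φ : ℝ in 𝓝[>] 0, |u φ| ≤ M * (φ ^ 2)⁻¹ := by
  have h0 := h.trans_tendsto tendsto_sq_mul_log_sq
  refine ⟨|k| + 1, ?_⟩
  filter_upwards [self_mem_nhdsWithin, h0.abs.eventually_lt_const (u := 1) (by simp)]
    with φ hφ hlt
  have hpos : 0 < φ ^ 2 := pow_pos (Set.mem_Ioi.1 hφ) 2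
  rw [← div_eq_mul_inv, le_div_iff₀ hpos, mul_comm]
  nth_rewrite 1 [← abs_of_pos hpos]
  rw [← abs_mul]
  calc |φ ^ 2 * u φ| = |k + (φ ^ 2 * u φ - k)| := by ring_nf
    _ ≤ |k| + |φ ^ 2 * u φ - k| := abs_add_le _ _
    _ ≤ |k| + 1 := by linarith


/-- Asymptotics of the exterior correction `ψ` relative to the profile `λ̄`
as `φ ↘ 0`: `ψ/λ̄ = λ̄((1/a)log φ + 1/a + (2n−2)C₁ − (1/(2a))log(2n−2) + O(φ²log(φ²)))`,
`ψ'/λ̄' = φ⁻²((n−1)/a² + O(φ²log(φ²)))`, `ψ''/λ̄'' = φ⁻²(−(n−1)/a² + O(φ²log(φ²)))`;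
consequently for `δ > 0` small there is `M₃` with `|ψ|, |ψ/λ̄| ≤ M₃(−log φ)` and
`|ψ'/λ̄'|, |ψ''/λ̄''| ≤ M₃ φ⁻²` on `(0, δ]`. -/
theorem psi_asymptotics_near_tip
    (n : ℕ) (hn : 2 ≤ n) (a c C₁ : ℝ) (ha : 0 < a)
    (hc : a * Real.log (2 * (n : ℝ) - 2) < c) (hC₁ : 0 < C₁)
    (lam ψ : ℝ → ℝ)
    (hlam : lam = fun φ => -1 / (c - a * Real.log (2 * (n : ℝ) - 2 - φ ^ 2)))
    (hψ : ψ = fun φ => (lam φ) ^ 2 *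
      (1 / a + C₁ * (2 * (n : ℝ) - 2 - φ ^ 2) +
        (2 * (n : ℝ) - 2 - φ ^ 2) / (4 * a * ((n : ℝ) - 1)) *
          (Real.log (φ ^ 2) - Real.log (2 * (n : ℝ) - 2 - φ ^ 2)))) :
    (fun φ : ℝ => ψ φ / lam φ / lam φ -
        (1 / a * Real.log φ + (1 / a + (2 * (n : ℝ) - 2) * C₁
          - 1 / (2 * a) * Real.log (2 * (n : ℝ) - 2))))
      =O[𝓝[>] 0] (fun φ : ℝ => φ ^ 2 * Real.log (φ ^ 2)) ∧
    (fun φ : ℝ => φ ^ 2 * (deriv ψ φ / deriv lam φ) - ((n : ℝ) - 1) / a ^ 2)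
      =O[𝓝[>] 0] (fun φ : ℝ => φ ^ 2 * Real.log (φ ^ 2)) ∧
    (fun φ : ℝ => φ ^ 2 * (deriv (deriv ψ) φ / deriv (deriv lam) φ) + ((n : ℝ) - 1) / a ^ 2)
      =O[𝓝[>] 0] (fun φ : ℝ => φ ^ 2 * Real.log (φ ^ 2)) ∧
    ∃ δ : ℝ, 0 < δ ∧ ∃ M₃ : ℝ, ∀ φ : ℝ, 0 < φ → φ ≤ δ →
      |ψ φ| ≤ M₃ * (-Real.log φ) ∧ |ψ φ / lam φ| ≤ M₃ * (-Real.log φ) ∧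
      |deriv ψ φ / deriv lam φ| ≤ M₃ * (φ ^ 2)⁻¹ ∧
      |deriv (deriv ψ) φ / deriv (deriv lam) φ| ≤ M₃ * (φ ^ 2)⁻¹ := by
  have hnR : (2 : ℝ) ≤ n := by exact_mod_cast hn
  have hN : 0 < 2 * (n : ℝ) - 2 := by linarith
  have hn1 : (n : ℝ) - 1 ≠ 0 := by linarith
  have hs : Tendsto (fun φ : ℝ => φ ^ 2) (𝓝[>] 0) (𝓝 0) :=
    ((continuous_pow 2).tendsto' (0 : ℝ) 0 (by norm_num)).mono_left nhdsWithin_le_nhds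
  set N : ℝ := 2 * (n : ℝ) - 2 with hNdef
  have hD : c - a * Real.log N ≠ 0 := by linarith
  set L : ℝ → ℝ := fun s => Real.log (N - s) with hL
  set Λ : ℝ → ℝ := fun s => -1 / (c - a * L s) with hΛdef
  set P : ℝ → ℝ := fun s => Λ s ^ 2 *
    (1 / a + C₁ * (N - s) - (N - s) / (4 * a * ((n : ℝ) - 1)) * L s) with hPdef
  set Q : ℝ → ℝ := fun s => Λ s ^ 2 * ((N - s) / (4 * a * ((n : ℝ) - 1))) with hQdef
  have hLan : AnalyticAt ℝ L 0 :=
    (analyticAt_const.sub analyticAt_id).log (by change 0 < N - 0; linarith)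
  have hΛan : AnalyticAt ℝ Λ 0 :=
    analyticAt_const.div (analyticAt_const.sub (analyticAt_const.mul hLan))
      (by simpa [hL] using hD)
  have hid : AnalyticAt ℝ (fun s : ℝ => s) 0 := analyticAt_id
  have hlin : AnalyticAt ℝ (fun s : ℝ => (N - s) / (4 * a * ((n : ℝ) - 1))) 0 :=
    (analyticAt_const.sub hid).div_const
  have hPan : AnalyticAt ℝ P 0 := by fun_prop
  have hQan : AnalyticAt ℝ Q 0 := by fun_prop
  have hΛ' : deriv Λ 0 = Λ 0 ^ 2 * (a / N) := by
    have h1 : HasDerivAt L (-1 / N) 0 := by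
      simpa using ((hasDerivAt_id (0 : ℝ)).const_sub N).log (by simpa using hN.ne')
    have h2 : HasDerivAt (fun s => c - a * L s) (a / N) 0 :=
      ((h1.const_mul a).const_sub c).congr_deriv (by ring)
    have hD' : c - a * L 0 ≠ 0 := by simpa [hL] using hD
    refine (((hasDerivAt_const (0 : ℝ) (-1 : ℝ)).div h2 hD').congr_deriv ?_).deriv
    simp only [hΛdef]
    field_simp
    ring
  have hΛ0 : Λ 0 ≠ 0 := by
    have hD' : c - a * L 0 ≠ 0 := by simpa [hL] using hD
    exact div_ne_zero (by norm_num) hD'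
  have hΛ'0 : deriv Λ 0 ≠ 0 := by
    rw [hΛ']
    positivity
  have hlam' : lam = fun φ => Λ (φ ^ 2) := hlam
  have hψ' : ψ = fun φ => P (φ ^ 2) + Q (φ ^ 2) * Real.log (φ ^ 2) := by
    rw [hψ, hlam']
    funext φ
    simp only [hPdef, hQdef, hL]
    ring
  have hratio : Q 0 / deriv Λ 0 = ((n : ℝ) - 1) / a ^ 2 := by
    rw [hΛ']
    simp only [hQdef, sub_zero]
    have hN2 : N = 2 * ((n : ℝ) - 1) := by rw [hNdef]; ring
    rw [hN2]
    field_simp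
    norm_num
  obtain ⟨hd1, hd2⟩ := isBigO_deriv_div_deriv hPan hQan hΛan hΛ'0 hψ' hlam'
  rw [hratio] at hd1 hd2
  have hΛne : ∀ᶠ φ : ℝ in 𝓝[>] 0, Λ (φ ^ 2) ≠ 0 :=
    hs.eventually (hΛan.continuousAt.eventually_ne hΛ0)
  have h0 : (fun φ : ℝ => ψ φ / lam φ / lam φ -
        (1 / a * Real.log φ + (1 / a + N * C₁ - 1 / (2 * a) * Real.log N)))
      =O[𝓝[>] 0] (fun φ : ℝ => φ ^ 2 * Real.log (φ ^ 2)) := by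
    have hA : AnalyticAt ℝ (fun s => 1 / a + C₁ * (N - s)
        - (N - s) / (4 * a * ((n : ℝ) - 1)) * L s) 0 := by fun_prop
    refine (isBigO_add_sq_mul_log_sub (B := fun _ => -1 / (4 * a * ((n : ℝ) - 1)))
      hA.differentiableAt continuousAt_const).congr' ?_ .rfl
    filter_upwards [hΛne] with φ hφ
    have hq : ψ φ / lam φ / lam φ = 1 / a + C₁ * (N - φ ^ 2)
        - (N - φ ^ 2) / (4 * a * ((n : ℝ) - 1)) * L (φ ^ 2)
        + (N - φ ^ 2) / (4 * a * ((n : ℝ) - 1)) * Real.log (φ ^ 2) := by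
      rw [hψ', hlam']
      simp only [hPdef, hQdef]
      field_simp
    rw [hq]
    simp only [hL, sub_zero, Real.log_pow, Nat.cast_ofNat]
    have hN2 : N / (4 * a * ((n : ℝ) - 1)) = 1 / (2 * a) := by
      rw [hNdef]
      field_simp
      ring
    rw [hN2, sub_div N, hN2]
    field_simp
    ring
  refine ⟨h0, hd1, hd2, ?_⟩
  obtain ⟨M₁, hM₁⟩ := exists_eventually_abs_le_mul_inv_sq hd1
  obtain ⟨M₂, hM₂⟩ := exists_eventually_abs_le_mul_inv_sq (k := -(((n : ℝ) - 1) / a ^ 2))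
    (by simpa using hd2)
  set K : ℝ := 1 / a + N * C₁ - 1 / (2 * a) * Real.log N
  set l : ℝ := |Λ 0| + 1
  have hl : 0 < l := by positivity
  have hlamb : ∀ᶠ φ : ℝ in 𝓝[>] 0, |Λ (φ ^ 2)| ≤ l :=
    (((hΛan.continuousAt.tendsto.comp hs).abs).eventually_lt_const
      (lt_add_one |Λ 0|)).mono fun _ h => le_of_lt h
  set m : ℝ := 1 / a + |K| + 1
  have hm : 0 < m := by positivity
  have hev : ∀ᶠ φ : ℝ in 𝓝[>] 0, |ψ φ / lam φ / lam φ| ≤ m * (-Real.log φ) := by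
    filter_upwards [Real.tendsto_log_nhdsGT_zero.eventually_le_atBot (-1),
      (h0.trans_tendsto tendsto_sq_mul_log_sq).abs.eventually_lt_const (u := 1) (by simp)]
      with φ hlog hlt
    have hlog' : 1 ≤ -Real.log φ := by linarith
    have e1 : |1 / a * Real.log φ| = 1 / a * (-Real.log φ) := by
      rw [abs_mul, abs_of_pos (by positivity), abs_of_nonpos (by linarith)]
    calc |ψ φ / lam φ / lam φ| = |1 / a * Real.log φ + K
          + (ψ φ / lam φ / lam φ - (1 / a * Real.log φ + K))| := by congr 1; ring
      _ ≤ |1 / a * Real.log φ| + |K| + 1 :=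
        (abs_add_le _ _).trans (add_le_add (abs_add_le _ _) hlt.le)
      _ ≤ m * (-Real.log φ) := by
        rw [e1]
        nlinarith [mul_le_mul_of_nonneg_left hlog' (abs_nonneg K)]
  have hall := (((((hev.and hlamb).and hM₁).and hM₂).and hΛne).and
    (Real.tendsto_log_nhdsGT_zero.eventually_le_atBot 0))
  obtain ⟨δ, hδ, hsub⟩ := mem_nhdsGT_iff_exists_Ioc_subset.1 hall
  refine ⟨δ, hδ, max (max (l * (l * m)) (l * m)) (max M₁ M₂), fun φ hφ hφδ => ?_⟩
  obtain ⟨⟨⟨⟨⟨hb, hlφ⟩, hb1⟩, hb2⟩, hne⟩, hlog⟩ := hsub ⟨hφ, hφδ⟩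
  have hlog' : 0 ≤ -Real.log φ := by linarith
  have hinv : 0 ≤ (φ ^ 2)⁻¹ := by positivity
  have hlamφ : lam φ = Λ (φ ^ 2) := by rw [hlam']
  rw [← hlamφ] at hne hlφ
  have hq : |ψ φ / lam φ| ≤ l * m * (-Real.log φ) := by
    calc |ψ φ / lam φ| = |lam φ| * |ψ φ / lam φ / lam φ| := by
          rw [← abs_mul, mul_div_cancel₀ _ hne]
      _ ≤ l * (m * (-Real.log φ)) := mul_le_mul hlφ hb (abs_nonneg _) hl.le
      _ = l * m * (-Real.log φ) := by ring
  have hp : |ψ φ| ≤ l * (l * m) * (-Real.log φ) := by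
    calc |ψ φ| = |lam φ| * |ψ φ / lam φ| := by
          rw [← abs_mul, mul_div_cancel₀ _ hne]
      _ ≤ l * (l * m * (-Real.log φ)) := mul_le_mul hlφ hq (abs_nonneg _) hl.le
      _ = l * (l * m) * (-Real.log φ) := by ring
  exact ⟨hp.trans (mul_le_mul_of_nonneg_right (by simp) hlog'),
    hq.trans (mul_le_mul_of_nonneg_right (by simp) hlog'),
    hb1.trans (mul_le_mul_of_nonneg_right (by simp) hinv),
    hb2.trans (mul_le_mul_of_nonneg_right (by simp) hinv)⟩
end

section
/- Fix an integer n ≥ 2, a > 0, and τ₀ < τ̄ < ∞. Let ζ⁺ and ζ⁻ be smooth non-positive functions on [−√(2(n−1)), √(2(n−1))] × [τ₀, τ̄] satisfying 𝓕_φ[ζ⁺] ≥ 0 and 𝓕_φ[ζ⁻] ≤ 0 at every point with φ ≠ 0. Assume: (C1) ζ⁻(φ,τ₀) ≤ ζ⁺(φ,τ₀) for all φ ∈ (−√(2(n−1)), √(2(n−1))); (C2) ζ⁻(−√(2(n−1)), τ) ≤ ζ⁺(−√(2(n−1)), τ) for all τ ∈ [τ₀, τ̄]; (C3) ζ⁻(√(2(n−1)),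 τ) ≤ ζ⁺(√(2(n−1)), τ) for all τ ∈ [τ₀, τ̄]. Then ζ⁻(φ,τ) ≤ ζ⁺(φ,τ) for all (φ,τ) ∈ [−√(2(n−1)), √(2(n−1))] × [τ₀, τ̄]. -/
open Filter Topology Set

/-- The exterior operator `𝓕_φ` of the rescaled mean curvature flow. -/
noncomputable def exteriorOp (n : ℕ) (a : ℝ) (lam : ℝ → ℝ → ℝ) (φ τ : ℝ) : ℝ :=
  deriv (fun τ' => lam φ τ') τ
    - (deriv (deriv (fun p => lam p τ)) φ - 2 * (deriv (fun p => lam p τ) φ) ^ 2 / lam φ τ)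
      / (1 + Real.exp τ * (deriv (fun p => lam p τ) φ) ^ 2 / (lam φ τ) ^ 4)
    - (((n : ℝ) - 1) / φ - φ / 2) * deriv (fun p => lam p τ) φ
    + a * (lam φ τ) ^ 2

/-- Partial derivative in the space variable. -/
noncomputable def dx (u : ℝ → ℝ → ℝ) (x τ : ℝ) : ℝ := deriv (fun p => u p τ) x

/-- Partial derivative in the time variable. -/
noncomputable def dt (u : ℝ → ℝ → ℝ) (x τ : ℝ) : ℝ := deriv (fun t => u x t) τ

/-- The second-order term of the equation satisfied by `-λ`, as a function of the value `L`, the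
slope `p` and the second derivative `Q`. -/
noncomputable def flux (E L p Q : ℝ) : ℝ := (Q - 2 * p ^ 2 / L) / (1 + E * p ^ 2 / L ^ 4)

lemma hasDerivAt_dx {u : ℝ → ℝ → ℝ} (hu : ContDiff ℝ (⊤ : ℕ∞) (Function.uncurry u)) (x τ : ℝ) :
    HasDerivAt (fun p => u p τ) (dx u x τ) x := by
  have h : ContDiff ℝ (⊤ : ℕ∞) (fun p => Function.uncurry u (p, τ)) :=
    hu.comp (contDiff_id.prodMk contDiff_const)
  exact ((h.differentiable (by simp)) x).hasDerivAt

lemma hasDerivAt_dt {u : ℝ → ℝ → ℝ} (hu : ContDiff ℝ (⊤ : ℕ∞) (Function.uncurry u)) (x τ : ℝ) :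
    HasDerivAt (fun t => u x t) (dt u x τ) τ := by
  have h : ContDiff ℝ (⊤ : ℕ∞) (fun t => Function.uncurry u (x, t)) :=
    hu.comp (contDiff_const.prodMk contDiff_id)
  exact ((h.differentiable (by simp)) τ).hasDerivAt

lemma contDiff_dx {u : ℝ → ℝ → ℝ} (hu : ContDiff ℝ (⊤ : ℕ∞) (Function.uncurry u)) :
    ContDiff ℝ (⊤ : ℕ∞) (Function.uncurry (dx u)) := by
  have h : Function.uncurry (dx u) = fun z => fderiv ℝ (Function.uncurry u) z (1, 0) := by
    ext ⟨x, τ⟩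
    have h1 : HasFDerivAt (Function.uncurry u) (fderiv ℝ (Function.uncurry u) (x, τ)) (x, τ) :=
      ((hu.differentiable (by simp)) _).hasFDerivAt
    have h2 : HasDerivAt (fun p : ℝ => (p, τ)) ((1 : ℝ), (0 : ℝ)) x :=
      (hasDerivAt_id x).prodMk (hasDerivAt_const x τ)
    exact (h1.comp_hasDerivAt x h2).deriv
  rw [h]
  exact (hu.fderiv_right (by simp)).clm_apply contDiff_const

lemma contDiff_dt {u : ℝ → ℝ → ℝ} (hu : ContDiff ℝ (⊤ : ℕ∞) (Function.uncurry u)) :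
    ContDiff ℝ (⊤ : ℕ∞) (Function.uncurry (dt u)) := by
  have h : Function.uncurry (dt u) = fun z => fderiv ℝ (Function.uncurry u) z (0, 1) := by
    ext ⟨x, τ⟩
    have h1 : HasFDerivAt (Function.uncurry u) (fderiv ℝ (Function.uncurry u) (x, τ)) (x, τ) :=
      ((hu.differentiable (by simp)) _).hasFDerivAt
    have h2 : HasDerivAt (fun t : ℝ => (x, t)) ((0 : ℝ), (1 : ℝ)) τ :=
      (hasDerivAt_const τ x).prodMk (hasDerivAt_id τ)
    exact (h1.comp_hasDerivAt τ h2).deriv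
  rw [h]
  exact (hu.fderiv_right (by simp)).clm_apply contDiff_const

lemma exists_abs_le_on_rectangle {u : ℝ → ℝ → ℝ}
    (hu : ContDiff ℝ (⊤ : ℕ∞) (Function.uncurry u)) (R s t : ℝ) :
    ∃ M, ∀ x ∈ Icc (-R) R, ∀ τ ∈ Icc s t, |u x τ| ≤ M := by
  obtain ⟨M, hM⟩ := ((isCompact_Icc (a := -R) (b := R)).prod
    (isCompact_Icc (a := s) (b := t))).exists_bound_of_continuousOn hu.continuous.continuousOn
  exact ⟨M, fun x hx τ hτ => hM (x, τ) ⟨hx, hτ⟩⟩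

lemma exteriorOp_neg (n : ℕ) (a : ℝ) (f : ℝ → ℝ → ℝ) (x τ : ℝ) :
    exteriorOp n a (fun p t => -f p t) x τ =
      flux (Real.exp τ) (f x τ) (dx f x τ) (dx (dx f) x τ) + a * f x τ ^ 2
        - (dt f x τ - (((n : ℝ) - 1) / x - x / 2) * dx f x τ) := by
  have h1 : deriv (fun p => -f p τ) = fun p => -dx f p τ := by
    ext p; simp [dx, deriv.fun_neg]
  have h2 : deriv (fun p => -dx f p τ) x = -dx (dx f) x τ := by
    rw [deriv.fun_neg]; rfl
  have h3 : deriv (fun t => -f x t) τ = -dt f x τ := by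
    rw [deriv.fun_neg]; rfl
  simp only [exteriorOp, flux, h1, h2, h3]
  ring

lemma flux_of_pos {E L : ℝ} (hE : 0 < E) (hL : 0 < L) (p Q : ℝ) :
    flux E L p Q = (L ^ 4 * Q - 2 * p ^ 2 * L ^ 3) / (L ^ 4 + E * p ^ 2) := by
  have : 0 < L ^ 4 + E * p ^ 2 := by positivity
  have : 0 < 1 + E * p ^ 2 / L ^ 4 := by positivity
  unfold flux
  field_simp

lemma flux_zero_slope (E L Q : ℝ) : flux E L 0 Q = Q := by
  simp [flux]

/-- A one-sided first-order condition at a maximum over earlier times. -/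
lemma deriv_nonneg_of_le_left {ψ : ℝ → ℝ} {c s t : ℝ} (hst : s < t) (h : HasDerivAt ψ c t)
    (hle : ∀ r ∈ Icc s t, ψ r ≤ ψ t) : 0 ≤ c := by
  have h1 : Tendsto (slope ψ t) (𝓝[<] t) (𝓝 c) :=
    (hasDerivAt_iff_tendsto_slope.1 h).mono_left (nhdsWithin_mono _ fun r hr => ne_of_lt hr)
  refine ge_of_tendsto h1 ?_
  filter_upwards [Ioo_mem_nhdsLT hst] with r hr
  rw [slope_def_field]
  exact div_nonneg_of_nonpos (by linarith [hle r ⟨hr.1.le, hr.2.le⟩]) (by linarith [hr.2])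

lemma second_deriv_nonpos_of_isLocalMax {v v' : ℝ → ℝ} {c x : ℝ}
    (h1 : ∀ y, HasDerivAt v (v' y) y) (h2 : HasDerivAt v' c x) (hmax : IsLocalMax v x) :
    c ≤ 0 := by
  by_contra! hc
  have e : deriv v = v' := funext fun y => (h1 y).deriv
  have hmin : IsLocalMin v x := isLocalMin_of_deriv_deriv_pos
    (by rw [e, h2.deriv]; exact hc) hmax.deriv_eq_zero (h1 x).continuousAt
  have hconst : v =ᶠ[𝓝 x] fun _ => v x := by
    filter_upwards [hmax, hmin] with y hy hy' using le_antisymm hy hy'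
  have h3 := hconst.deriv.deriv_eq
  simp [e, h2.deriv] at h3
  exact hc.ne' h3

/-- The limit at the origin of a differential inequality with singular drift. -/
lemma drift_inequality_at_zero {k q : ℝ} (hk : 0 < k) {v w r : ℝ → ℝ} (hv : HasDerivAt v q 0)
    (hw : ContinuousAt w 0) (hr : ContinuousAt r 0)
    (h : ∀ᶠ x in 𝓝[≠] 0, w x - (k / x - x / 2) * v x ≤ r x) :
    v 0 = 0 ∧ w 0 - k * q ≤ r 0 := by
  have hc : Tendsto (fun x => x * w x - (k - x ^ 2 / 2) * v x - x * r x) (𝓝 0)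
      (𝓝 (0 * w 0 - (k - 0 ^ 2 / 2) * v 0 - 0 * r 0)) := by
    have : ContinuousAt (fun x => x * w x - (k - x ^ 2 / 2) * v x - x * r x) 0 := by
      have := hv.continuousAt
      fun_prop
    exact this
  have hid : ∀ x : ℝ, x ≠ 0 → x * w x - (k - x ^ 2 / 2) * v x - x * r x =
      x * (w x - (k / x - x / 2) * v x - r x) := by
    intro x hx; field_simp
  have hpos : 0 * w 0 - (k - 0 ^ 2 / 2) * v 0 - 0 * r 0 ≤ 0 := by
    refine le_of_tendsto (hc.mono_left (nhdsWithin_le_nhds (s := Ioi 0))) ?_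
    filter_upwards [h.filter_mono (nhdsWithin_mono _ fun r hr => ne_of_gt hr),
      self_mem_nhdsWithin] with x hx hx0
    rw [hid x (ne_of_gt hx0)]
    exact mul_nonpos_of_nonneg_of_nonpos (le_of_lt hx0) (by linarith)
  have hneg : 0 ≤ 0 * w 0 - (k - 0 ^ 2 / 2) * v 0 - 0 * r 0 := by
    refine ge_of_tendsto (hc.mono_left (nhdsWithin_le_nhds (s := Iio 0))) ?_
    filter_upwards [h.filter_mono (nhdsWithin_mono _ fun r hr => ne_of_lt hr),
      self_mem_nhdsWithin] with x hx hx0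
    rw [hid x (ne_of_lt hx0)]
    exact mul_nonneg_of_nonpos_of_nonpos (le_of_lt hx0) (by linarith)
  have hv0 : v 0 = 0 := by
    have : k * v 0 = 0 := by nlinarith
    exact (mul_eq_zero.1 this).resolve_left hk.ne'
  refine ⟨hv0, ?_⟩
  have hs := hasDerivAt_iff_tendsto_slope.1 hv
  have hL : Tendsto (fun x => w x - (k * slope v 0 x - x / 2 * v x)) (𝓝[≠] 0)
      (𝓝 (w 0 - (k * q - 0 / 2 * v 0))) :=
    (hw.tendsto.mono_left nhdsWithin_le_nhds).sub ((hs.const_mul k).sub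
      (((continuousAt_id.div_const 2).mul hv.continuousAt).tendsto.mono_left nhdsWithin_le_nhds))
  have := le_of_tendsto_of_tendsto hL (hr.tendsto.mono_left nhdsWithin_le_nhds) (by
    filter_upwards [h] with x hx
    refine le_trans (le_of_eq ?_) hx
    rw [slope_def_field, hv0]
    ring)
  simpa using this

lemma flux_lower_bound {E L : ℝ} (hE : 0 < E) (hL : 0 ≤ L) {p : ℝ} (hp : L = 0 → p = 0) (Q : ℝ) :
    min Q 0 - 2 / E * L ^ 3 ≤ flux E L p Q := by
  rcases hL.eq_or_lt with h0 | h0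
  · rw [hp h0.symm, flux_zero_slope, ← h0]
    simp
  · have hD : 0 < L ^ 4 + E * p ^ 2 := by positivity
    rw [flux_of_pos hE h0, le_div_iff₀ hD]
    have h1 : 2 / E * L ^ 3 * (L ^ 4 + E * p ^ 2) = 2 / E * L ^ 7 + 2 * p ^ 2 * L ^ 3 := by
      field_simp
    have h2 : min Q 0 * (L ^ 4 + E * p ^ 2) ≤ L ^ 4 * Q := by
      have : min Q 0 * (E * p ^ 2) ≤ 0 :=
        mul_nonpos_of_nonpos_of_nonneg (min_le_right _ _) (by positivity)
      have := mul_le_mul_of_nonneg_right (min_le_left Q 0) (by positivity : 0 ≤ L ^ 4)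
      linarith
    have h3 : 0 ≤ 2 / E * L ^ 7 := by positivity
    nlinarith

/-- At a touching point with common slope `p`, the difference of the two fluxes is controlled
linearly by the difference of the values, provided the upper function satisfies a linear bound
where its second derivative dominates its value. -/
lemma flux_sub_le {E₀ B K C a : ℝ} (hE₀ : 0 < E₀) (hK : 0 ≤ K) (hC : 0 ≤ C) (ha : 0 ≤ a) :
    ∃ D, ∀ E l m p Qp Qm gp gm : ℝ, E₀ ≤ E → 0 ≤ m → m < l → l ≤ B → (m = 0 → p = 0) →
      Qp ≤ Qm → gp ≤ flux E l p Qp + a * l ^ 2 → flux E m p Qm + a * m ^ 2 ≤ gm →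
      (K * l < Qp → gp ≤ C * l) → gp - gm ≤ D * (l - m) := by
  refine ⟨2 * B ^ 2 / E₀ + 2 * a * B + 4 * K + 64 * (C + 2 * B ^ 2 / E₀), ?_⟩
  intro E l m p Qp Qm gp gm hE hm hml hlB hmp hQ hgp hgm hbad
  have hl : 0 < l := hm.trans_lt hml
  have hB : 0 < B := hl.trans_le hlB
  have hE0 : 0 < E := hE₀.trans_le hE
  have hd : 0 < l - m := sub_pos.2 hml
  have hc1 : 0 ≤ 2 * B ^ 2 / E₀ * (l - m) := by positivity
  have hc2 : 0 ≤ K * (l - m) := by positivity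
  have hc3 : 0 ≤ C * (l - m) := by positivity
  have hsq : a * l ^ 2 - a * m ^ 2 ≤ 2 * a * B * (l - m) := by
    have : (l + m) * (a * (l - m)) ≤ (2 * B) * (a * (l - m)) := by gcongr; linarith
    linarith
  have hc4 : 0 ≤ 2 * a * B * (l - m) := by positivity
  rcases eq_or_ne p 0 with rfl | hp
  · rw [flux_zero_slope] at hgp hgm
    linarith
  have hm0 : 0 < m := lt_of_le_of_ne hm fun h => hp (hmp h.symm)
  rw [flux_of_pos hE0 hl] at hgp
  rw [flux_of_pos hE0 hm0] at hgm
  have hp2 : 0 < p ^ 2 := by positivity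
  have hP : 0 < E * p ^ 2 := by positivity
  set P := E * p ^ 2 with hPdef
  have hL4 : 0 < l ^ 4 + P := by positivity
  have hM4 : 0 < m ^ 4 + P := by positivity
  have hlm4 : l ^ 4 - m ^ 4 ≤ 4 * l ^ 3 * (l - m) := by
    have h1 : m ^ 2 * l ≤ l ^ 2 * l := by gcongr
    have h2 : m * l ^ 2 ≤ l * l ^ 2 := by gcongr
    have h3 : m ^ 3 ≤ l ^ 3 := by gcongr
    have h4 : (l ^ 3 + l ^ 2 * m + l * m ^ 2 + m ^ 3) * (l - m) ≤ 4 * l ^ 3 * (l - m) := by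
      gcongr; linarith
    linarith
  have hlm4' : 0 ≤ l ^ 4 - m ^ 4 := sub_nonneg.2 (by gcongr)
  obtain ⟨Al, hAl⟩ : ∃ A, A = l ^ 4 / (l ^ 4 + P) := ⟨_, rfl⟩
  obtain ⟨Am, hAm⟩ : ∃ A, A = m ^ 4 / (m ^ 4 + P) := ⟨_, rfl⟩
  obtain ⟨Sl, hSl⟩ : ∃ A, A = 2 * p ^ 2 * l ^ 3 / (l ^ 4 + P) := ⟨_, rfl⟩
  obtain ⟨Sm, hSm⟩ : ∃ A, A = 2 * p ^ 2 * m ^ 3 / (m ^ 4 + P) := ⟨_, rfl⟩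
  have hgp' : gp ≤ Al * Qp - Sl + a * l ^ 2 := by
    refine hgp.trans (le_of_eq ?_); rw [hAl, hSl]; ring
  have hgm' : Am * Qm - Sm + a * m ^ 2 ≤ gm := by
    refine le_trans (le_of_eq ?_) hgm; rw [hAm, hSm]; ring
  have hAm0 : 0 < Am := by rw [hAm]; positivity
  have hAdiff : Al - Am = P * (l ^ 4 - m ^ 4) / ((l ^ 4 + P) * (m ^ 4 + P)) := by
    rw [hAl, hAm]; field_simp; ring
  have hA0 : 0 ≤ Al - Am := by rw [hAdiff]; positivity
  have hA1 : (Al - Am) * l ≤ 4 * (l - m) := by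
    have h1 : Al - Am ≤ (l ^ 4 - m ^ 4) / l ^ 4 := by
      rw [hAdiff, div_le_div_iff₀ (by positivity) (by positivity)]
      have : P * l ^ 4 ≤ (l ^ 4 + P) * (m ^ 4 + P) := by
        have : 0 ≤ l ^ 4 * m ^ 4 + P * m ^ 4 + P ^ 2 := by positivity
        linarith
      nlinarith
    have h2 : (l ^ 4 - m ^ 4) / l ^ 4 ≤ 4 * l ^ 3 * (l - m) / l ^ 4 := by gcongr
    calc (Al - Am) * l ≤ 4 * l ^ 3 * (l - m) / l ^ 4 * l := by gcongr; linarith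
      _ = 4 * (l - m) := by field_simp
  have hSm1 : Sm ≤ 2 * B ^ 2 / E₀ * l := by
    have h1 : Sm ≤ 2 / E * m ^ 3 := by
      rw [hSm, div_le_iff₀ hM4]
      have : 2 / E * m ^ 3 * (m ^ 4 + P) = 2 / E * m ^ 7 + 2 * p ^ 2 * m ^ 3 := by
        rw [hPdef]; field_simp
      have : 0 ≤ 2 / E * m ^ 7 := by positivity
      linarith
    have h2 : 2 / E * m ^ 3 ≤ 2 / E₀ * (B ^ 2 * l) := by
      have : m ^ 3 ≤ B ^ 2 * l := by
        calc m ^ 3 = m ^ 2 * m := by ring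
          _ ≤ B ^ 2 * l := by gcongr; linarith
      gcongr
    calc Sm ≤ 2 / E₀ * (B ^ 2 * l) := h1.trans h2
      _ = _ := by ring
  have hSdiff : Sm - Sl ≤ 2 * B ^ 2 / E₀ * (l - m) := by
    have h1 : Sm - Sl = 2 * p ^ 2 * (m ^ 3 * l ^ 3 * (l - m) - P * (l ^ 3 - m ^ 3)) /
        ((l ^ 4 + P) * (m ^ 4 + P)) := by
      rw [hSm, hSl]; field_simp; ring
    have hcube : 0 ≤ P * (l ^ 3 - m ^ 3) :=
      mul_nonneg hP.le (sub_nonneg.2 (by gcongr))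
    have h2 : Sm - Sl ≤ 2 * p ^ 2 * (m ^ 3 * l ^ 3 * (l - m)) / (l ^ 4 * P) := by
      rw [h1]
      gcongr
      · linarith
      · linarith
      · have : 0 < m ^ 4 := by positivity
        linarith
    have h3 : 2 * p ^ 2 * (m ^ 3 * l ^ 3 * (l - m)) / (l ^ 4 * P)
        = 2 / E * (m ^ 3 / l) * (l - m) := by
      rw [hPdef]; field_simp
    have h4 : m ^ 3 / l ≤ B ^ 2 := by
      rw [div_le_iff₀ hl]
      calc m ^ 3 = m ^ 2 * m := by ring
          _ ≤ B ^ 2 * l := by gcongr; linarith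
    calc Sm - Sl ≤ 2 / E * (m ^ 3 / l) * (l - m) := h2.trans h3.le
      _ ≤ 2 / E₀ * B ^ 2 * (l - m) := by gcongr
      _ = _ := by ring
  have hAmQ : Am * Qp ≤ Am * Qm := by gcongr
  have hmain : gp - gm ≤ (Al - Am) * Qp + 2 * B ^ 2 / E₀ * (l - m) + 2 * a * B * (l - m) := by
    linarith
  rcases le_or_gt Qp (K * l) with hQK | hQK
  · have : (Al - Am) * Qp ≤ 4 * K * (l - m) := by
      calc (Al - Am) * Qp ≤ (Al - Am) * (K * l) := by gcongr
        _ = K * ((Al - Am) * l) := by ring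
        _ ≤ K * (4 * (l - m)) := by gcongr
        _ = _ := by ring
    linarith
  · have hgpl := hbad hQK
    have hQ0 : 0 < Qp := lt_of_le_of_lt (by positivity) hQK
    have ham : 0 ≤ a * m ^ 2 := by positivity
    by_cases hpos : gp ≤ gm
    · linarith
    push Not at hpos
    have hAQ : Am * Qp ≤ (C + 2 * B ^ 2 / E₀) * l := by linarith
    rcases le_or_gt (l / 2) m with hhalf | hhalf
    · have hA2 : Al - Am ≤ Am * (64 * (l - m) / l) := by
        have h1 : Al - Am = Am * (P / (l ^ 4 + P)) * ((l ^ 4 - m ^ 4) / m ^ 4) := by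
          rw [hAdiff, hAm]; field_simp
        have h2 : P / (l ^ 4 + P) ≤ 1 := by
          rw [div_le_one hL4]
          have : 0 < l ^ 4 := by positivity
          linarith
        have h3 : (l ^ 4 - m ^ 4) / m ^ 4 ≤ 64 * (l - m) / l := by
          have : (l / 2) ^ 4 ≤ m ^ 4 := by gcongr
          calc (l ^ 4 - m ^ 4) / m ^ 4 ≤ 4 * l ^ 3 * (l - m) / (l / 2) ^ 4 := by gcongr
            _ = _ := by field_simp; norm_num
        rw [h1]
        calc Am * (P / (l ^ 4 + P)) * ((l ^ 4 - m ^ 4) / m ^ 4)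
            ≤ Am * 1 * (64 * (l - m) / l) := by gcongr
          _ = _ := by ring
      have : (Al - Am) * Qp ≤ 64 * (C + 2 * B ^ 2 / E₀) * (l - m) := by
        calc (Al - Am) * Qp ≤ Am * (64 * (l - m) / l) * Qp := by gcongr
          _ = Am * Qp * (64 * (l - m) / l) := by ring
          _ ≤ (C + 2 * B ^ 2 / E₀) * l * (64 * (l - m) / l) := by gcongr
          _ = _ := by field_simp
      linarith
    · have hAQ0 : 0 < Am * Qp := by positivity
      have h1 : gp - gm ≤ (C + 2 * B ^ 2 / E₀) * l := by linarith
      have h2 : (C + 2 * B ^ 2 / E₀) * l ≤ (C + 2 * B ^ 2 / E₀) * (2 * (l - m)) := by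
        gcongr; linarith
      linarith

lemma exists_direction {R x : ℝ} (hx : |x| < R) (hx0 : x ≠ 0) :
    ∃ σ : ℝ, |σ| = 1 ∧ ∀ s, 0 < s → s ≤ R / 4 → |x + σ * s| < R ∧ x + σ * s ≠ 0 := by
  obtain ⟨h1, h2⟩ := abs_lt.1 hx
  rcases lt_or_gt_of_ne hx0 with h | h
  · by_cases h3 : x < -(R / 2)
    · refine ⟨1, by simp, fun s hs hs' => ⟨abs_lt.2 ⟨?_, ?_⟩, ne_of_lt ?_⟩⟩ <;> linarith
    · refine ⟨-1, by simp, fun s hs hs' => ⟨abs_lt.2 ⟨?_, ?_⟩, ne_of_lt ?_⟩⟩ <;> linarith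
  · by_cases h3 : R / 2 < x
    · refine ⟨-1, by simp, fun s hs hs' => ⟨abs_lt.2 ⟨?_, ?_⟩, ne_of_gt ?_⟩⟩ <;> linarith
    · refine ⟨1, by simp, fun s hs hs' => ⟨abs_lt.2 ⟨?_, ?_⟩, ne_of_gt ?_⟩⟩ <;> linarith

lemma abs_sub_le_of_abs_deriv_le {v v' : ℝ → ℝ} {R M : ℝ} (hv : ∀ x, HasDerivAt v (v' x) x)
    (hM : ∀ x ∈ Icc (-R) R, |v' x| ≤ M) {x y : ℝ} (hx : x ∈ Icc (-R) R) (hy : y ∈ Icc (-R) R) :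
    |v y - v x| ≤ M * |y - x| :=
  (convex_Icc (-R) R).norm_image_sub_le_of_norm_hasDerivWithin_le
    (fun z _ => (hv z).hasDerivWithinAt) hM hx hy

lemma abs_div_sub_div_le {v v' : ℝ → ℝ} {R M : ℝ} (hv : ∀ x, HasDerivAt v (v' x) x)
    (hM : ∀ x ∈ Icc (-R) R, ∀ y ∈ Icc (-R) R, |v' y - v' x| ≤ M * |y - x|) (hM0 : 0 ≤ M)
    (hv0 : v 0 = 0) {x y : ℝ} (hx : x ∈ Icc (-R) R) (hy : y ∈ Icc (-R) R) (hx0 : x ≠ 0)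
    (hy0 : y ≠ 0) : |v y / y - v x / x| ≤ M * |y - x| := by
  have hd : ∀ θ ∈ Icc (0 : ℝ) 1, HasDerivWithinAt (fun θ => v (θ * y) / y - v (θ * x) / x)
      (v' (θ * y) - v' (θ * x)) (Icc 0 1) θ := by
    intro θ _
    have h : ∀ z : ℝ, z ≠ 0 → HasDerivAt (fun θ => v (θ * z) / z) (v' (θ * z)) θ := by
      intro z hz
      have := ((hv (θ * z)).comp θ ((hasDerivAt_id θ).mul_const z)).div_const z
      simpa [Function.comp_def, hz] using this
    exact ((h y hy0).sub (h x hx0)).hasDerivWithinAt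
  have hscale : ∀ θ ∈ Icc (0 : ℝ) 1, ∀ z ∈ Icc (-R) R, θ * z ∈ Icc (-R) R := by
    intro θ hθ z hz
    rw [mem_Icc, ← abs_le] at hz ⊢
    rw [abs_mul, abs_of_nonneg hθ.1]
    exact (mul_le_of_le_one_left (abs_nonneg z) hθ.2).trans hz
  have hb : ∀ θ ∈ Icc (0 : ℝ) 1, ‖v' (θ * y) - v' (θ * x)‖ ≤ M * |y - x| := by
    intro θ hθ
    refine (hM _ (hscale θ hθ x hx) _ (hscale θ hθ y hy)).trans ?_
    rw [← mul_sub, abs_mul, abs_of_nonneg hθ.1]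
    gcongr
    exact mul_le_of_le_one_left (abs_nonneg _) hθ.2
  have := (convex_Icc (0 : ℝ) 1).norm_image_sub_le_of_norm_hasDerivWithin_le hd hb
    (left_mem_Icc.2 zero_le_one) (right_mem_Icc.2 zero_le_one)
  simpa [hv0] using this

lemma abs_sub_linear_le {v v' : ℝ → ℝ} {R M : ℝ} (hv : ∀ x, HasDerivAt v (v' x) x)
    (hM : ∀ x ∈ Icc (-R) R, ∀ y ∈ Icc (-R) R, |v' y - v' x| ≤ M * |y - x|) (hM0 : 0 ≤ M)
    {x y : ℝ} (hx : x ∈ Icc (-R) R) (hy : y ∈ Icc (-R) R) :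
    |v y - v x - v' x * (y - x)| ≤ M * |y - x| ^ 2 := by
  have hd : ∀ z ∈ uIcc x y, HasDerivWithinAt (fun z => v z - v' x * z) (v' z - v' x)
      (uIcc x y) z := by
    intro z _
    have := (hv z).sub ((hasDerivAt_id z).const_mul (v' x))
    simp only [mul_one] at this
    exact this.hasDerivWithinAt
  have hb : ∀ z ∈ uIcc x y, ‖v' z - v' x‖ ≤ M * |y - x| := by
    intro z hz
    refine (hM x hx z (uIcc_subset_Icc hx hy hz)).trans ?_
    exact mul_le_mul_of_nonneg_left (abs_sub_left_of_mem_uIcc hz) hM0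
  have := (convex_uIcc x y).norm_image_sub_le_of_norm_hasDerivWithin_le hd hb
    left_mem_uIcc right_mem_uIcc
  simp only [Real.norm_eq_abs] at this
  calc |v y - v x - v' x * (y - x)| = |v y - v' x * y - (v x - v' x * x)| := by congr 1; ring
    _ ≤ M * |y - x| * |y - x| := this
    _ = _ := by ring

/-- Where the second derivative dominates the value, a supersolution of the one-sided slice
inequality satisfies a linear bound: at a nearby point the slope is large enough to make the flux
small, and the left-hand side is Lipschitz. -/
lemma linear_bound_of_convex {R M E₀ a k : ℝ} (hR : 0 < R) (hM : 0 < M) (hE₀ : 0 < E₀)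
    (ha : 0 ≤ a) (hk : 0 ≤ k) :
    ∃ K C, 0 ≤ K ∧ 0 ≤ C ∧ ∀ (E : ℝ) (u u₁ u₂ w : ℝ → ℝ), E₀ ≤ E →
      (∀ x, HasDerivAt u (u₁ x) x) → (∀ x, HasDerivAt u₁ (u₂ x) x) →
      (∀ x ∈ Icc (-R) R, |u₁ x| ≤ M) → (∀ x ∈ Icc (-R) R, |u₂ x| ≤ M) →
      (∀ x ∈ Icc (-R) R, ∀ y ∈ Icc (-R) R, |u₂ y - u₂ x| ≤ M * |y - x|) →
      (∀ x ∈ Icc (-R) R, ∀ y ∈ Icc (-R) R, |w y - w x| ≤ M * |y - x|) →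
      u₁ 0 = 0 → (∀ x ∈ Icc (-R) R, 0 ≤ u x) →
      (∀ x ∈ Icc (-R) R, x ≠ 0 →
        w x - (k / x - x / 2) * u₁ x ≤ flux E (u x) (u₁ x) (u₂ x) + a * u x ^ 2) →
      ∀ x, |x| < R → x ≠ 0 → 0 < u x → K * u x < u₂ x →
        w x - (k / x - x / 2) * u₁ x ≤ C * u x := by
  refine ⟨18 * M + 12 * M / R + 1,
    8 * (1 + 3 * M) ^ 4 / E₀ + a * (1 + 3 * M) ^ 2 + 3 * M + 3 * k * M + 2 * (M + R * M),
    by positivity, by positivity, ?_⟩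
  intro E u u₁ u₂ w hE hu hu₁ hM₁ hM₂ hL₂ hLw hu₁0 hu0 hineq x hx hx0 hux hKx
  obtain ⟨l, hl⟩ : ∃ l, l = u x := ⟨_, rfl⟩
  obtain ⟨Q, hQ⟩ : ∃ Q, Q = u₂ x := ⟨_, rfl⟩
  rw [← hl] at hux
  rw [← hl, ← hQ] at hKx
  have hxI : x ∈ Icc (-R) R := abs_le.1 hx.le
  have hQM : Q ≤ M := hQ ▸ (le_abs_self _).trans (hM₂ x hxI)
  have hMl : 0 < M * l := by positivity
  have hRl : 0 < 12 * M / R * l := by positivity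
  have hexp : 18 * (M * l) + 12 * M / R * l + l < Q := by linarith
  have hQ0 : 0 < Q := by linarith
  have hlQ : l ≤ Q := by linarith
  have hl1 : l ≤ 1 := by
    by_contra! h
    nlinarith
  have hlR : 3 * l ≤ R / 4 := by
    have h1 : 12 * M / R * l < M := by linarith
    have h2 : 12 * M / R * l = M * (12 * l / R) := by ring
    have h3 : 12 * l / R < 1 := by
      by_contra! h
      nlinarith
    rw [div_lt_one hR] at h3
    linarith
  obtain ⟨σ, hσ, hdir⟩ := exists_direction hx hx0
  have htaylor : ∀ s, 0 < s → s ≤ 3 * l →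
      |u₁ (x + σ * s) - u₁ x - Q * (σ * s)| ≤ Q * l / 2 := by
    intro s hs hs'
    have h1 := abs_sub_linear_le hu₁ hL₂ hM.le hxI (abs_le.1 (hdir s hs (hs'.trans hlR)).1.le)
    rw [add_sub_cancel_left, abs_mul, hσ, one_mul, abs_of_pos hs, ← hQ] at h1
    have h2 : M * s ^ 2 ≤ M * (3 * l) ^ 2 := by gcongr
    have h3 : 18 * (M * l) * l ≤ Q * l := by gcongr; linarith
    linarith
  have hσ2 : σ * σ = 1 := by
    rw [← abs_mul_abs_self, hσ, one_mul]
  obtain ⟨s, hs0, hs, hslope⟩ : ∃ s, 0 < s ∧ s ≤ 3 * l ∧ Q * l / 2 ≤ |u₁ (x + σ * s)| := by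
    by_contra! h
    have h1 := abs_lt.1 (h l hux (by linarith))
    have h3 := abs_lt.1 (h (3 * l) (by linarith) le_rfl)
    have t1 := abs_le.1 (htaylor l hux (by linarith))
    have t3 := abs_le.1 (htaylor (3 * l) (by linarith) le_rfl)
    have hQl : 0 < Q * l := by positivity
    rcases (abs_eq zero_le_one).1 hσ with rfl | rfl <;> linarith [h1.1, h1.2, h3.1, h3.2, t1.1,
      t1.2, t3.1, t3.2]
  obtain ⟨hyR, hy0⟩ := hdir s hs0 (hs.trans hlR)
  obtain ⟨y, hy⟩ : ∃ y, y = x + σ * s := ⟨_, rfl⟩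
  rw [← hy] at hslope hyR hy0
  have hyI : y ∈ Icc (-R) R := abs_le.1 hyR.le
  have hdist : |y - x| ≤ 3 * l := by
    rw [hy, add_sub_cancel_left, abs_mul, hσ, one_mul, abs_of_pos hs0]
    exact hs
  have hMdist : M * |y - x| ≤ 3 * (M * l) := by
    have : M * |y - x| ≤ M * (3 * l) := by gcongr
    linarith
  have huy : u y ≤ (1 + 3 * M) * l := by
    have := (abs_le.1 (abs_sub_le_of_abs_deriv_le hu hM₁ hxI hyI)).2
    rw [← hl] at this
    linarith
  have hu₂y : u₂ y ≤ 2 * Q := by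
    have := (abs_le.1 (hL₂ x hxI y hyI)).2
    rw [← hQ] at this
    linarith
  have hslope0 : 0 < |u₁ y| := lt_of_lt_of_le (by positivity) hslope
  have huy0 : 0 < u y := by
    refine lt_of_le_of_ne (hu0 y hyI) fun h => ?_
    have hmin : IsLocalMin u y := by
      filter_upwards [Icc_mem_nhds (abs_lt.1 hyR).1 (abs_lt.1 hyR).2] with z hz
      rw [← h]
      exact hu0 z hz
    rw [hmin.hasDerivAt_eq_zero (hu y)] at hslope0
    simp at hslope0
  have hflux : flux E (u y) (u₁ y) (u₂ y) ≤ 8 * (1 + 3 * M) ^ 4 / E₀ * l := by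
    have hE0 := hE₀.trans_le hE
    rw [flux_of_pos hE0 huy0]
    have hp : Q * l / 2 * (Q * l / 2) ≤ u₁ y ^ 2 := by
      rw [← abs_mul_abs_self, abs_mul_abs_self, ← sq, ← sq_abs (u₁ y)]
      gcongr
    have h1 : u y ^ 4 * u₂ y - 2 * u₁ y ^ 2 * u y ^ 3 ≤ ((1 + 3 * M) * l) ^ 4 * (2 * Q) := by
      have h2 : u y ^ 4 * u₂ y ≤ u y ^ 4 * (2 * Q) := by gcongr
      have h3 : u y ^ 4 * (2 * Q) ≤ ((1 + 3 * M) * l) ^ 4 * (2 * Q) := by gcongr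
      have h4 : 0 ≤ 2 * u₁ y ^ 2 * u y ^ 3 := by positivity
      linarith
    have h5 : E₀ * (Q * l / 2 * (Q * l / 2)) ≤ u y ^ 4 + E * u₁ y ^ 2 := by
      have h6 : E₀ * (Q * l / 2 * (Q * l / 2)) ≤ E * u₁ y ^ 2 := by gcongr
      have : 0 < u y ^ 4 := by positivity
      linarith
    calc (u y ^ 4 * u₂ y - 2 * u₁ y ^ 2 * u y ^ 3) / (u y ^ 4 + E * u₁ y ^ 2)
        ≤ ((1 + 3 * M) * l) ^ 4 * (2 * Q) / (E₀ * (Q * l / 2 * (Q * l / 2))) := by gcongr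
      _ = 8 * (1 + 3 * M) ^ 4 / E₀ * l * (l / Q) := by field_simp; norm_num
      _ ≤ 8 * (1 + 3 * M) ^ 4 / E₀ * l * 1 := by
        gcongr
        exact (div_le_one hQ0).2 hlQ
      _ = _ := mul_one _
  have hsq : a * u y ^ 2 ≤ a * (1 + 3 * M) ^ 2 * l := by
    calc a * u y ^ 2 ≤ a * ((1 + 3 * M) * l) ^ 2 := by gcongr
      _ = a * (1 + 3 * M) ^ 2 * l * l := by ring
      _ ≤ a * (1 + 3 * M) ^ 2 * l * 1 := by gcongr
      _ = _ := mul_one _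
  have hy' := hineq y hyI hy0
  have hw := (abs_le.1 (hLw x hxI y hyI)).1
  have hquot : k * (u₁ y / y - u₁ x / x) ≤ 3 * k * M * l := by
    have h1 := (le_abs_self _).trans
      ((abs_div_sub_div_le hu₁ hL₂ hM.le hu₁0 hxI hyI hx0 hy0).trans hMdist)
    calc k * (u₁ y / y - u₁ x / x) ≤ k * (3 * (M * l)) := by gcongr
      _ = _ := by ring
  have hlin : x / 2 * u₁ x - y / 2 * u₁ y ≤ 2 * (M + R * M) * l := by
    have h1 := abs_sub_le_of_abs_deriv_le hu₁ hM₂ hxI hyI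
    have h2 : |x * (u₁ y - u₁ x)| ≤ R * (3 * (M * l)) := by
      rw [abs_mul]
      gcongr
      exact h1.trans hMdist
    have h3 : |(y - x) * u₁ y| ≤ 3 * l * M := by
      rw [abs_mul]
      gcongr
      exact hM₁ y hyI
    have h4 := (abs_le.1 h2).1
    have h5 := (abs_le.1 h3).1
    have h6 : 0 ≤ R * (M * l) := by positivity
    linarith
  have e1 : w x - (k / x - x / 2) * u₁ x = w y - (k / y - y / 2) * u₁ y + (w x - w y) +
      k * (u₁ y / y - u₁ x / x) + (x / 2 * u₁ x - y / 2 * u₁ y) := by ring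
  rw [e1, ← hl]
  linarith

/-- Comparison principle for `𝓕_φ[λ] = 0`: if `ζ⁺` and `ζ⁻` are smooth
non-positive super- and subsolutions on `[−√(2(n−1)), √(2(n−1))] × [τ₀, τ̄]` which are
ordered at the initial time `τ₀` and on the lateral boundaries `φ = ±√(2(n−1))`, then
`ζ⁻ ≤ ζ⁺` on the whole space-time region. -/
theorem comparison_principle
    (n : ℕ) (hn : 2 ≤ n) (a : ℝ) (ha : 0 < a)
    (τ₀ τb : ℝ) (hτ : τ₀ < τb)
    (ζp ζm : ℝ → ℝ → ℝ)
    (hζp : ContDiff ℝ (⊤ : ℕ∞) (Function.uncurry ζp))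
    (hζm : ContDiff ℝ (⊤ : ℕ∞) (Function.uncurry ζm))
    (hζpNonpos : ∀ φ τ : ℝ, |φ| ≤ Real.sqrt (2 * ((n : ℝ) - 1)) → τ ∈ Icc τ₀ τb →
      ζp φ τ ≤ 0)
    (hζmNonpos : ∀ φ τ : ℝ, |φ| ≤ Real.sqrt (2 * ((n : ℝ) - 1)) → τ ∈ Icc τ₀ τb →
      ζm φ τ ≤ 0)
    (hSuper : ∀ φ τ : ℝ, |φ| ≤ Real.sqrt (2 * ((n : ℝ) - 1)) → τ ∈ Icc τ₀ τb → φ ≠ 0 →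
      0 ≤ exteriorOp n a ζp φ τ)
    (hSub : ∀ φ τ : ℝ, |φ| ≤ Real.sqrt (2 * ((n : ℝ) - 1)) → τ ∈ Icc τ₀ τb → φ ≠ 0 →
      exteriorOp n a ζm φ τ ≤ 0)
    (hC1 : ∀ φ : ℝ, |φ| < Real.sqrt (2 * ((n : ℝ) - 1)) → ζm φ τ₀ ≤ ζp φ τ₀)
    (hC2 : ∀ τ ∈ Icc τ₀ τb,
      ζm (-Real.sqrt (2 * ((n : ℝ) - 1))) τ ≤ ζp (-Real.sqrt (2 * ((n : ℝ) - 1))) τ)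
    (hC3 : ∀ τ ∈ Icc τ₀ τb,
      ζm (Real.sqrt (2 * ((n : ℝ) - 1))) τ ≤ ζp (Real.sqrt (2 * ((n : ℝ) - 1))) τ) :
    ∀ φ τ : ℝ, |φ| ≤ Real.sqrt (2 * ((n : ℝ) - 1)) → τ ∈ Icc τ₀ τb →
      ζm φ τ ≤ ζp φ τ := by
  obtain ⟨k, hk⟩ : ∃ k, k = (n : ℝ) - 1 := ⟨_, rfl⟩
  have hk0 : 0 < k := by
    have : (2 : ℝ) ≤ n := by exact_mod_cast hn
    linarith
  rw [← hk] at hζpNonpos hζmNonpos hSuper hSub hC1 hC2 hC3 ⊢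
  obtain ⟨R, hRdef⟩ : ∃ R, R = Real.sqrt (2 * k) := ⟨_, rfl⟩
  have hR : 0 < R := hRdef ▸ Real.sqrt_pos.2 (by positivity)
  rw [← hRdef] at hζpNonpos hζmNonpos hSuper hSub hC1 hC2 hC3 ⊢
  obtain ⟨f, hfdef⟩ : ∃ f : ℝ → ℝ → ℝ, f = fun x τ => -ζp x τ := ⟨_, rfl⟩
  obtain ⟨h, hhdef⟩ : ∃ h : ℝ → ℝ → ℝ, h = fun x τ => -ζm x τ := ⟨_, rfl⟩
  have hζpf : ζp = fun x τ => -f x τ := by simp [hfdef]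
  have hζmh : ζm = fun x τ => -h x τ := by simp [hhdef]
  have hf : ContDiff ℝ (⊤ : ℕ∞) (Function.uncurry f) := hfdef ▸ hζp.neg
  have hh : ContDiff ℝ (⊤ : ℕ∞) (Function.uncurry h) := hhdef ▸ hζm.neg
  clear hfdef hhdef hζp hζm
  subst hζpf hζmh
  simp only [Left.neg_nonpos_iff, neg_le_neg_iff] at hζpNonpos hζmNonpos hC1 hC2 hC3 ⊢
  simp only [exteriorOp_neg, ← hk, sub_nonneg, sub_nonpos] at hSuper hSub
  simp only [abs_le] at hζpNonpos hζmNonpos hSuper hSub ⊢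
  change ∀ x τ, x ∈ Icc (-R) R → _ at hζpNonpos hζmNonpos hSuper hSub
  have hf₁ := contDiff_dx hf
  have hf₂ := contDiff_dx hf₁
  have hf₃ := contDiff_dx hf₂
  have hft := contDiff_dt hf
  have hh₁ := contDiff_dx hh
  have hh₂ := contDiff_dx hh₁
  have hht := contDiff_dt hh
  obtain ⟨B, hB⟩ := exists_abs_le_on_rectangle hf R τ₀ τb
  obtain ⟨M₁, hM₁⟩ := exists_abs_le_on_rectangle hf₁ R τ₀ τb
  obtain ⟨M₂, hM₂⟩ := exists_abs_le_on_rectangle hf₂ R τ₀ τb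
  obtain ⟨M₃, hM₃⟩ := exists_abs_le_on_rectangle hf₃ R τ₀ τb
  obtain ⟨M₄, hM₄⟩ := exists_abs_le_on_rectangle (contDiff_dx hft) R τ₀ τb
  obtain ⟨M, hM⟩ : ∃ M, M = |M₁| + |M₂| + |M₃| + |M₄| + 1 := ⟨_, rfl⟩
  have hM0 : 0 < M := by rw [hM]; positivity
  have hM₁M : M₁ ≤ M := by
    linarith [le_abs_self M₁, abs_nonneg M₂, abs_nonneg M₃, abs_nonneg M₄]
  have hM₂M : M₂ ≤ M := by
    linarith [le_abs_self M₂, abs_nonneg M₁, abs_nonneg M₃, abs_nonneg M₄]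
  have hM₃M : M₃ ≤ M := by
    linarith [le_abs_self M₃, abs_nonneg M₂, abs_nonneg M₁, abs_nonneg M₄]
  have hM₄M : M₄ ≤ M := by
    linarith [le_abs_self M₄, abs_nonneg M₂, abs_nonneg M₃, abs_nonneg M₁]
  obtain ⟨K, C, hK, hC, hlin⟩ := linear_bound_of_convex hR hM0 (Real.exp_pos τ₀) ha.le hk0.le
  obtain ⟨D, hD⟩ := flux_sub_le (B := B) (Real.exp_pos τ₀) hK hC ha.le
  obtain ⟨μ, hμ⟩ : ∃ μ, μ = |D| + 2 * a * |B| + 1 := ⟨_, rfl⟩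
  intro x₁ t₁ hx₁ ht₁
  by_contra! hlt
  obtain ⟨⟨x, t⟩, ⟨hx, ht⟩, hmax⟩ := ((isCompact_Icc (a := -R) (b := R)).prod
    (isCompact_Icc (a := τ₀) (b := τb))).exists_isMaxOn
    (f := fun z : ℝ × ℝ => Real.exp (-μ * z.2) * (Function.uncurry f z - Function.uncurry h z))
    ⟨(x₁, t₁), hx₁, ht₁⟩ (by
      have := hf.continuous
      have := hh.continuous
      exact Continuous.continuousOn (by fun_prop))
  have hmax' : ∀ y ∈ Icc (-R) R, ∀ s ∈ Icc τ₀ τb,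
      Real.exp (-μ * s) * (f y s - h y s) ≤ Real.exp (-μ * t) * (f x t - h x t) :=
    fun y hy s hs => hmax (show (y, s) ∈ Icc (-R) R ×ˢ Icc τ₀ τb from ⟨hy, hs⟩)
  change x ∈ Icc (-R) R at hx
  change t ∈ Icc τ₀ τb at ht
  have hd : 0 < f x t - h x t := by
    have h1 := hmax' x₁ hx₁ t₁ ht₁
    have h2 : 0 < Real.exp (-μ * t₁) * (f x₁ t₁ - h x₁ t₁) :=
      mul_pos (Real.exp_pos _) (sub_pos.2 hlt)
    exact pos_of_mul_pos_right (h2.trans_le h1) (Real.exp_pos _).le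
  have hxR : |x| < R := by
    refine lt_of_le_of_ne (abs_le.2 hx) fun hxe => ?_
    rcases (abs_eq hR.le).1 hxe with rfl | rfl
    · linarith [hC3 t ht]
    · linarith [hC2 t ht]
  have htτ : τ₀ < t := by
    refine lt_of_le_of_ne ht.1 fun he => ?_
    have := hC1 x hxR
    rw [he] at this
    linarith
  have hnhds : Icc (-R) R ∈ 𝓝 x := Icc_mem_nhds (abs_lt.1 hxR).1 (abs_lt.1 hxR).2
  have hlocmax : IsLocalMax (fun y => f y t - h y t) x := by
    filter_upwards [hnhds] with y hy
    exact le_of_mul_le_mul_left (hmax' y hy t ht) (Real.exp_pos _)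
  have hdv : ∀ y, HasDerivAt (fun y => f y t - h y t) (dx f y t - dx h y t) y :=
    fun y => (hasDerivAt_dx hf y t).sub (hasDerivAt_dx hh y t)
  have hslope : dx h x t = dx f x t := by
    linarith [hlocmax.hasDerivAt_eq_zero (hdv x)]
  have hconc : dx (dx f) x t ≤ dx (dx h) x t := by
    have := second_deriv_nonpos_of_isLocalMax hdv
      ((hasDerivAt_dx hf₁ x t).sub (hasDerivAt_dx hh₁ x t)) hlocmax
    linarith
  have htime : μ * (f x t - h x t) ≤ dt f x t - dt h x t := by
    have hder : HasDerivAt (fun s => Real.exp (-μ * s) * (f x s - h x s))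
        (Real.exp (-μ * t) * (dt f x t - dt h x t - μ * (f x t - h x t))) t := by
      have h1 := (((hasDerivAt_id t).const_mul (-μ)).exp).mul
        ((hasDerivAt_dt hf x t).sub (hasDerivAt_dt hh x t))
      refine h1.congr_deriv ?_
      simp
      ring
    have h2 := deriv_nonneg_of_le_left htτ hder fun s hs =>
      hmax' x hx s ⟨hs.1, hs.2.trans ht.2⟩
    linarith [nonneg_of_mul_nonneg_right h2 (Real.exp_pos _)]
  have hh0 : 0 ≤ h x t := hζmNonpos x t hx ht
  have hflB : f x t ≤ B := (le_abs_self _).trans (hB x hx t ht)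
  have hfpos : 0 < f x t := by linarith
  have hslope_zero : ∀ u : ℝ → ℝ → ℝ, ContDiff ℝ (⊤ : ℕ∞) (Function.uncurry u) →
      (∀ y τ, y ∈ Icc (-R) R → τ ∈ Icc τ₀ τb → 0 ≤ u y τ) →
      ∀ y, |y| < R → u y t = 0 → IsLocalMin (fun y => u y t) y ∧ dx u y t = 0 := by
    intro u hu hu0 y hy huy
    have hmin : IsLocalMin (fun y => u y t) y := by
      filter_upwards [Icc_mem_nhds (abs_lt.1 hy).1 (abs_lt.1 hy).2] with z hz
      rw [huy]
      exact hu0 z t hz ht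
    exact ⟨hmin, hmin.hasDerivAt_eq_zero (hasDerivAt_dx hu y t)⟩
  have h0R : |(0 : ℝ)| < R := by simpa using hR
  have hnear : ∀ᶠ y in 𝓝[≠] (0 : ℝ), y ∈ Icc (-R) R ∧ y ≠ 0 := by
    filter_upwards [nhdsWithin_le_nhds (Icc_mem_nhds (neg_lt_zero.2 hR) hR),
      self_mem_nhdsWithin] with y hy hy0 using ⟨hy, hy0⟩
  have hcont : ∀ u : ℝ → ℝ → ℝ, ContDiff ℝ (⊤ : ℕ∞) (Function.uncurry u) →
      Continuous fun y => u y t := fun u hu =>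
    hu.continuous.comp (continuous_id.prodMk continuous_const)
  have hcontflux : ∀ u : ℝ → ℝ → ℝ, ContDiff ℝ (⊤ : ℕ∞) (Function.uncurry u) → 0 < u 0 t →
      ContinuousAt (fun y => flux (Real.exp t) (u y t) (dx u y t) (dx (dx u) y t)
        + a * u y t ^ 2) 0 := by
    intro u hu hu0
    have c0 := (hcont u hu).continuousAt (x := 0)
    have c1 := (hcont _ (contDiff_dx hu)).continuousAt (x := 0)
    have c2 := (hcont _ (contDiff_dx (contDiff_dx hu))).continuousAt (x := 0)
    have n1 : u 0 t ≠ 0 := hu0.ne'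
    have n2 : u 0 t ^ 4 ≠ 0 := by positivity
    have n3 : 1 + Real.exp t * dx u 0 t ^ 2 / u 0 t ^ 4 ≠ 0 := by positivity
    unfold flux
    exact ((c2.sub ((continuousAt_const.mul (c1.pow 2)).div c0 n1)).div
      (continuousAt_const.add ((continuousAt_const.mul (c1.pow 2)).div (c0.pow 4) n2)) n3).add
      (continuousAt_const.mul (c0.pow 2))
  have hf_origin : 0 < f 0 t → dx f 0 t = 0 ∧ dt f 0 t - k * dx (dx f) 0 t ≤
      flux (Real.exp t) (f 0 t) (dx f 0 t) (dx (dx f) 0 t) + a * f 0 t ^ 2 := fun hf0 =>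
    drift_inequality_at_zero hk0 (hasDerivAt_dx hf₁ 0 t) (hcont _ hft).continuousAt
      (hcontflux f hf hf0) (hnear.mono fun y hy => hSuper y t hy.1 ht hy.2)
  have hμd : D * (f x t - h x t) < μ * (f x t - h x t) ∧
      2 * a * B * (f x t - h x t) < μ * (f x t - h x t) := by
    have h1 : 0 ≤ a * |B| := by positivity
    have h2 : a * B ≤ a * |B| := by gcongr; exact le_abs_self B
    constructor <;> refine mul_lt_mul_of_pos_right ?_ hd <;>
      linarith [le_abs_self D, abs_nonneg D]
  rcases eq_or_ne x 0 with rfl | hx0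
  · obtain ⟨hp, hfle⟩ := hf_origin hfpos
    rw [hp, flux_zero_slope] at hfle
    have hhle : dx (dx h) 0 t + a * h 0 t ^ 2 ≤ dt h 0 t - k * dx (dx h) 0 t := by
      rcases hh0.eq_or_lt with hz | hz
      · obtain ⟨hmin, hp'⟩ := hslope_zero h hh hζmNonpos 0 h0R hz.symm
        have hconv : 0 ≤ dx (dx h) 0 t := by
          have := second_deriv_nonpos_of_isLocalMax (fun y => (hasDerivAt_dx hh y t).fun_neg)
            (hasDerivAt_dx hh₁ 0 t).fun_neg hmin.neg
          linarith
        have htneg : dt h 0 t ≤ 0 := by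
          have := deriv_nonneg_of_le_left htτ (hasDerivAt_dt hh 0 t).fun_neg fun s hs => by
            rw [← hz, neg_zero, neg_nonpos]
            exact hζmNonpos 0 s hx ⟨hs.1, hs.2.trans ht.2⟩
          linarith
        have hlow := (drift_inequality_at_zero (w := fun y => -dt h y t)
          (r := fun y => -(min (dx (dx h) y t) 0 - 2 / Real.exp t * h y t ^ 3)) hk0
          (hasDerivAt_dx hh₁ 0 t).fun_neg (hcont _ hht).neg.continuousAt
          (by
            have c0 := hcont h hh
            have c2 := hcont _ hh₂
            exact Continuous.continuousAt (by fun_prop))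
          (by
            filter_upwards [hnear, nhdsWithin_le_nhds (isOpen_Ioo.mem_nhds (abs_lt.1 h0R))]
              with y hy hyR
            have h1 := hSub y t hy.1 ht hy.2
            have h2 := flux_lower_bound (Real.exp_pos t) (hζmNonpos y t hy.1 ht)
              (fun hz => (hslope_zero h hh hζmNonpos y (abs_lt.2 hyR) hz).2) (dx (dx h) y t)
            have h3 : 0 ≤ a * h y t ^ 2 := by positivity
            linarith)).2
        simp only [← hz, min_eq_right hconv] at hlow ⊢
        have hQ : dx (dx h) 0 t ≤ 0 := by
          by_contra! hpos
          have := mul_pos hk0 hpos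
          linarith
        have hQ0 : dx (dx h) 0 t = 0 := le_antisymm hQ hconv
        rw [hQ0] at hlow ⊢
        linarith
      · have := (drift_inequality_at_zero hk0 (hasDerivAt_dx hh₁ 0 t).fun_neg
          (hcont _ hht).neg.continuousAt (hcontflux h hh hz).neg
          (hnear.mono fun y hy => by
            have := hSub y t hy.1 ht hy.2
            simp only [Pi.neg_apply]
            linarith)).2
        simp only [Pi.neg_apply, hslope, hp, flux_zero_slope] at this
        linarith
    have h1 : k * dx (dx f) 0 t ≤ k * dx (dx h) 0 t := by gcongr
    have h2 : a * f 0 t ^ 2 - a * h 0 t ^ 2 ≤ 2 * a * B * (f 0 t - h 0 t) := by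
      have : (f 0 t + h 0 t) * (a * (f 0 t - h 0 t)) ≤ (2 * B) * (a * (f 0 t - h 0 t)) := by
        gcongr; linarith
      linarith
    linarith [hμd.2]
  · have hfzero : dx f 0 t = 0 := by
      rcases (hζpNonpos 0 t (abs_le.1 h0R.le) ht).eq_or_lt with hz | hz
      · exact (hslope_zero f hf hζpNonpos 0 h0R hz.symm).2
      · exact (hf_origin hz).1
    have hexp : Real.exp τ₀ ≤ Real.exp t := Real.exp_le_exp.2 ht.1
    have hbad := hlin (Real.exp t) (fun y => f y t) (fun y => dx f y t) (fun y => dx (dx f) y t)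
      (fun y => dt f y t) hexp (fun y => hasDerivAt_dx hf y t) (fun y => hasDerivAt_dx hf₁ y t)
      (fun y hy => (hM₁ y hy t ht).trans hM₁M) (fun y hy => (hM₂ y hy t ht).trans hM₂M)
      (fun y hy z hz => abs_sub_le_of_abs_deriv_le (fun y => hasDerivAt_dx hf₂ y t)
        (fun y hy => (hM₃ y hy t ht).trans hM₃M) hy hz)
      (fun y hy z hz => abs_sub_le_of_abs_deriv_le (fun y => hasDerivAt_dx hft y t)
        (fun y hy => (hM₄ y hy t ht).trans hM₄M) hy hz)
      hfzero (fun y hy => hζpNonpos y t hy ht) (fun y hy hy0 => hSuper y t hy ht hy0)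
      x hxR hx0 hfpos
    have hsub := hSub x t hx ht hx0
    rw [hslope] at hsub
    have := hD (Real.exp t) (f x t) (h x t) (dx f x t) (dx (dx f) x t) (dx (dx h) x t) _ _ hexp
      hh0 (sub_pos.1 hd) hflB (fun hz => hslope ▸ (hslope_zero h hh hζmNonpos x hxR hz).2) hconc
      (hSuper x t hx ht hx0) hsub hbad
    linarith [hμd.1]
end

section
/- Fix an integer n ≥ 2, constants 0 ≤ t̄ < T < ∞ and C ≥ 1. Let x₀ : [0, t̄] → ℝ and let u(x,t) be smooth and positive for x > x₀(t), t ∈ [0, t̄], with u(x₀(t), t) = 0, u_x > 0 and u_xx < 0 (so the rotationally symmetric hypersurface with profile r = u(·,t) is a complete noncompact strictly convex graph), solving u_t = u_xx/(1+u_x²) − (n−1)/u, with uniformly bounded second fundamental form on [0, t̄], and such that ℜ := −u·u_xx/(1+u_x²) extends continuously to the tip x = x₀(t) with value ℜ = 1 there for every t. If ℜ ≤ C at t = 0, then ℜ ≤ C for all t ∈ [0, t̄]. -/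
open Filter Topology Set

/-- Spatial derivative `u_x` of a profile function `u(x,t)`. -/
noncomputable def uX (u : ℝ → ℝ → ℝ) (x t : ℝ) : ℝ := deriv (fun x' => u x' t) x

/-- Second spatial derivative `u_xx`. -/
noncomputable def uXX (u : ℝ → ℝ → ℝ) (x t : ℝ) : ℝ := deriv (deriv (fun x' => u x' t)) x

/-- Time derivative `u_t`. -/
noncomputable def uT (u : ℝ → ℝ → ℝ) (x t : ℝ) : ℝ := deriv (fun t' => u x t') t

/-- The curvature ratio `ℜ = κ_n/κ₁ = −u·u_xx/(1+u_x²)`. -/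
noncomputable def ratioR (u : ℝ → ℝ → ℝ) (x t : ℝ) : ℝ :=
  -(u x t) * uXX u x t / (1 + (uX u x t) ^ 2)

open scoped ContDiff

/-- A real function on a compact interval which is lower semicontinuous, can only jump to
arbitrarily large values, and grows at most by a fixed amount along half-open intervals of
upper semicontinuity, is upper semicontinuous. -/
theorem eventually_lt_of_jump_dichotomy {f : ℝ → ℝ} {a b D : ℝ}
    (hlsc : LowerSemicontinuousOn f (Icc a b))
    (hjump : ∀ t ∈ Icc a b, ∀ y, f t < y → ∀ N, ∀ᶠ s in 𝓝[Icc a b] t, f s < y ∨ N < f s)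
    (hgrow : ∀ r ∈ Icc a b, ∀ s ∈ Icc a b, r < s →
      (∀ τ ∈ Ioc r s, ∀ y, f τ < y → ∀ᶠ σ in 𝓝[Icc a b] τ, f σ < y) → f s ≤ f r + D) :
    ∀ t ∈ Icc a b, ∀ y, f t < y → ∀ᶠ s in 𝓝[Icc a b] t, f s < y := by
  have hbdd : ∀ t ∈ Icc a b, (∃ N, ∀ᶠ s in 𝓝[Icc a b] t, f s ≤ N) →
      ∀ y, f t < y → ∀ᶠ s in 𝓝[Icc a b] t, f s < y := by
    rintro t ht ⟨N, hN⟩ y hy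
    filter_upwards [hN, hjump t ht y hy N] with s h1 h2
    exact h2.resolve_right (not_lt.2 h1)
  set P : Set ℝ := {t | t ∈ Icc a b ∧ ¬ ∃ N, ∀ᶠ s in 𝓝[Icc a b] t, f s ≤ N} with hP
  have hPclosed : IsClosed P := by
    rw [← isOpen_compl_iff, isOpen_iff_mem_nhds]
    intro t ht
    by_cases htI : t ∈ Icc a b
    · have : ∃ N, ∀ᶠ s in 𝓝[Icc a b] t, f s ≤ N := by
        by_contra h
        exact ht ⟨htI, h⟩
      obtain ⟨N, hN⟩ := this
      rw [← eventually_eventually_nhdsWithin] at hN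
      have := eventually_nhdsWithin_iff.1 hN
      filter_upwards [this] with s hs hsP
      exact hsP.2 ⟨N, hs hsP.1⟩
    · filter_upwards [isClosed_Icc.isOpen_compl.mem_nhds htI] with s hs hsP
      exact hs hsP.1
  suffices hPe : P = ∅ by
    intro t ht
    refine hbdd t ht ?_
    by_contra h
    have : t ∈ P := ⟨ht, h⟩
    simp [hPe] at this
  by_contra hne
  have hne : P.Nonempty := nonempty_iff_ne_empty.2 hne
  have hPI : P ⊆ Icc a b := fun t ht => ht.1
  have : Nonempty P := hne.to_subtype
  have : CompleteSpace P := hPclosed.completeSpace_coe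
  obtain ⟨N, ⟨⟨t, htP⟩, ht⟩⟩ := nonempty_interior_of_iUnion_of_closed
    (f := fun N : ℕ => {t : P | f t ≤ N})
    (fun N => by
      have := (lowerSemicontinuous_restrict_iff.2 (hlsc.mono hPI)).isClosed_preimage (N : ℝ)
      simpa [preimage, Set.domRestrict] using this)
    (eq_univ_of_forall fun t => by
      obtain ⟨N, hN⟩ := exists_nat_ge (f t)
      exact mem_iUnion.2 ⟨N, hN⟩)
  rw [mem_interior_iff_mem_nhds, mem_nhds_subtype] at ht
  obtain ⟨U, hU, hUN⟩ := ht
  obtain ⟨δ, hδ, hball⟩ := Metric.mem_nhds_iff.1 hU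
  have hN : ∀ s ∈ P, |s - t| < δ → f s ≤ N := fun s hs hst =>
    @hUN ⟨s, hs⟩ (hball (by simpa [Real.dist_eq] using hst))
  obtain ⟨r, hrI, hrt, hrδ, hrn⟩ : ∃ r ∈ Icc a b, r ≤ t ∧ t - δ < r ∧ Ici r ∈ 𝓝[Icc a b] t := by
    rcases eq_or_lt_of_le htP.1.1 with h | h
    · refine ⟨a, ⟨le_rfl, htP.1.1.trans htP.1.2⟩, htP.1.1, by linarith, ?_⟩
      filter_upwards [self_mem_nhdsWithin] with s hs using hs.1
    · refine ⟨max a (t - δ / 2), ⟨le_max_left _ _, max_le (htP.1.1.trans htP.1.2)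
        (by linarith [htP.1.2])⟩, max_le h.le (by linarith),
        lt_of_lt_of_le (by linarith) (le_max_right _ _), mem_nhdsWithin_of_mem_nhds ?_⟩
      exact Ici_mem_nhds (max_lt h (by linarith))
  refine htP.2 ⟨max (N : ℝ) (f r) + |D|, ?_⟩
  filter_upwards [hrn, self_mem_nhdsWithin,
    mem_nhdsWithin_of_mem_nhds (Iio_mem_nhds (by linarith : t < t + δ))] with s hrs hsI hsδ
  have hregular : ∀ τ ∈ Icc a b, τ ∉ P → ∀ y, f τ < y → ∀ᶠ σ in 𝓝[Icc a b] τ, f σ < y := by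
    intro τ hτ hτP
    exact hbdd τ hτ (by_contra fun h => hτP ⟨hτ, h⟩)
  have hrs : r ≤ s := hrs
  have hsδ : s < t + δ := hsδ
  have hD := le_abs_self D
  have hD0 := abs_nonneg D
  have hN1 := le_max_left (N : ℝ) (f r)
  have hN2 := le_max_right (N : ℝ) (f r)
  by_cases hcase : (P ∩ Icc r s).Nonempty
  · obtain ⟨p, hp, hpmax⟩ := (isCompact_Icc.inter_left hPclosed).exists_isGreatest hcase
    have hfp : f p ≤ N := hN p hp.1 (abs_lt.2 ⟨by linarith [hp.2.1], by linarith [hp.2.2]⟩)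
    rcases eq_or_lt_of_le hp.2.2 with h | h
    · rw [← h]; linarith
    · have := hgrow p hp.1.1 s hsI h fun τ hτ => hregular τ
        ⟨hp.1.1.1.trans hτ.1.le, hτ.2.trans hsI.2⟩ fun hτP =>
        absurd (hpmax ⟨hτP, hp.2.1.trans hτ.1.le, hτ.2⟩) (not_le.2 hτ.1)
      linarith
  · rcases eq_or_lt_of_le hrs with h | h
    · rw [← h]; linarith
    · have := hgrow r hrI s hsI h fun τ hτ => hregular τ
        ⟨hrI.1.trans hτ.1.le, hτ.2.trans hsI.2⟩ fun hτP =>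
        hcase ⟨τ, hτP, hτ.1.le, hτ.2⟩
      linarith

theorem HasFDerivWithinAt.hasDerivAt_fst {f : ℝ → ℝ → ℝ} {s : Set (ℝ × ℝ)} {x t : ℝ}
    {f' : ℝ × ℝ →L[ℝ] ℝ} (hf : HasFDerivWithinAt (Function.uncurry f) f' s (x, t))
    (hs : ∀ᶠ y in 𝓝 x, (y, t) ∈ s) : HasDerivAt (fun y => f y t) (f' (1, 0)) x := by
  have h1 : HasDerivWithinAt (fun y : ℝ => (y, t)) (1, 0) {y | (y, t) ∈ s} x :=
    ((hasDerivAt_id x).prodMk (hasDerivAt_const x t)).hasDerivWithinAt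
  have := hf.comp_hasDerivWithinAt (f := fun y : ℝ => (y, t)) x h1 (fun y hy => hy)
  exact this.hasDerivAt hs

/-- Partial differentiation in the first variable preserves smoothness on sets with open
horizontal slices. -/
theorem ContDiffOn.uncurry_uX {f : ℝ → ℝ → ℝ} {s : Set (ℝ × ℝ)}
    (hs : ∀ z ∈ s, ∀ᶠ y in 𝓝 z.1, (y, z.2) ∈ s)
    (hf : ContDiffOn ℝ ∞ (Function.uncurry f) s) :
    ContDiffOn ℝ ∞ (Function.uncurry (uX f)) s := by
  rw [contDiffOn_infty]
  intro m z hz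
  have h := (hf.of_le (m := (m : ℕ∞ω) + 1) (by exact_mod_cast le_top)) z hz
  obtain ⟨v, hv, hvs, -, f', hf', hc⟩ :=
    (contDiffWithinAt_succ_iff_hasFDerivWithinAt' (by simp)).1 h
  rw [insert_eq_of_mem hz] at hv hvs
  have hc' : ContDiffWithinAt ℝ m (fun y => f' y (1, 0)) s z := hc.clm_apply contDiffWithinAt_const
  refine hc'.congr_of_eventuallyEq_of_mem ?_ hz
  filter_upwards [hv] with y hy
  exact ((hf' y hy).hasDerivAt_fst (hs y (hvs hy))).deriv

theorem ContDiffOn.hasDerivAt_uX {f : ℝ → ℝ → ℝ} {s : Set (ℝ × ℝ)} {x t : ℝ}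
    (hf : ContDiffOn ℝ ∞ (Function.uncurry f) s) (hx : (x, t) ∈ s)
    (hs : ∀ᶠ y in 𝓝 x, (y, t) ∈ s) : HasDerivAt (fun y => f y t) (uX f x t) x := by
  have := (hf.differentiableOn (by simp) (x, t) hx).hasFDerivWithinAt.hasDerivAt_fst hs
  exact this.differentiableAt.hasDerivAt

theorem DifferentiableAt.fderiv_uncurry_apply {f : ℝ → ℝ → ℝ} {x t : ℝ}
    (hf : DifferentiableAt ℝ (Function.uncurry f) (x, t)) (v : ℝ × ℝ) :
    fderiv ℝ (Function.uncurry f) (x, t) v = v.1 * uX f x t + v.2 * uT f x t := by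
  have hx : uX f x t = fderiv ℝ (Function.uncurry f) (x, t) (1, 0) :=
    (hf.hasFDerivAt.hasFDerivWithinAt (s := univ) |>.hasDerivAt_fst (by simp)).deriv
  have ht : uT f x t = fderiv ℝ (Function.uncurry f) (x, t) (0, 1) :=
    (hf.hasFDerivAt.comp_hasDerivAt t ((hasDerivAt_const t x).prodMk (hasDerivAt_id t))).deriv
  rw [hx, ht, ← smul_eq_mul, ← smul_eq_mul, ← map_smul, ← map_smul, ← map_add]
  simp

/-- Equality of mixed partial derivatives. -/
theorem ContDiffAt.hasDerivAt_uX_time {f : ℝ → ℝ → ℝ} {x t : ℝ}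
    (hf : ContDiffAt ℝ 2 (Function.uncurry f) (x, t)) :
    HasDerivAt (fun s => uX f x s) (deriv (fun y => uT f y t) x) t := by
  have hd : ∀ᶠ z in 𝓝 (x, t), DifferentiableAt ℝ (Function.uncurry f) z :=
    (hf.eventually (by simp)).mono fun z hz => hz.differentiableAt (by simp)
  have h2 : DifferentiableAt ℝ (fderiv ℝ (Function.uncurry f)) (x, t) :=
    (hf.fderiv_right (m := 1) (by norm_num)).differentiableAt (by simp)
  have hsymm := hf.isSymmSndFDerivAt (by simp)
  set F := fderiv ℝ (Function.uncurry f) with hF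
  have hct : Tendsto (fun s : ℝ => (x, s)) (𝓝 t) (𝓝 (x, t)) :=
    (Continuous.prodMk_right x).tendsto t
  have hcx : Tendsto (fun y : ℝ => (y, t)) (𝓝 x) (𝓝 (x, t)) :=
    (Continuous.prodMk_left t).tendsto x
  have ht : HasDerivAt (fun s => F (x, s) (1, 0)) (fderiv ℝ F (x, t) (0, 1) (1, 0)) t := by
    have h := h2.hasFDerivAt.comp_hasDerivAt t
      ((hasDerivAt_const t x).prodMk (hasDerivAt_id t))
    simpa using h.clm_apply (hasDerivAt_const t ((1, 0) : ℝ × ℝ))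
  have hx : HasDerivAt (fun y => F (y, t) (0, 1)) (fderiv ℝ F (x, t) (1, 0) (0, 1)) x := by
    have h := h2.hasFDerivAt.comp_hasDerivAt x
      ((hasDerivAt_id x).prodMk (hasDerivAt_const x t))
    simpa using h.clm_apply (hasDerivAt_const x ((0, 1) : ℝ × ℝ))
  have hx' : HasDerivAt (fun y => uT f y t) (fderiv ℝ F (x, t) (1, 0) (0, 1)) x := by
    refine hx.congr_of_eventuallyEq ?_
    filter_upwards [hcx.eventually hd] with y hy
    simp [hF, DifferentiableAt.fderiv_uncurry_apply hy]
  rw [hx'.deriv, hsymm.eq (1, 0) (0, 1)]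
  refine ht.congr_of_eventuallyEq ?_
  filter_upwards [hct.eventually hd] with y hy
  simp [hF, DifferentiableAt.fderiv_uncurry_apply hy]

theorem HasDerivAt.eventually_lt_nhdsGT {f : ℝ → ℝ} {f' a : ℝ} (hf : HasDerivAt f f' a)
    (h : 0 < f') : ∀ᶠ x in 𝓝[>] a, f a < f x := by
  have := (hasDerivWithinAt_iff_tendsto_slope' (notMem_Ioi.2 le_rfl)).1
    (hf.hasDerivWithinAt (s := Ioi a))
  filter_upwards [this.eventually_const_lt h, self_mem_nhdsWithin] with x hx hax
  exact (slope_pos_iff_of_le (le_of_lt hax)).1 hx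

theorem HasDerivAt.eventually_gt_nhdsLT {f : ℝ → ℝ} {f' a : ℝ} (hf : HasDerivAt f f' a)
    (h : f' < 0) : ∀ᶠ x in 𝓝[<] a, f a < f x := by
  have := (hasDerivWithinAt_iff_tendsto_slope' (notMem_Iio.2 le_rfl)).1
    (hf.hasDerivWithinAt (s := Iio a))
  filter_upwards [this.eventually_lt_const h, self_mem_nhdsWithin] with x hx hax
  have hxa : x - a < 0 := sub_neg.2 hax
  rw [slope_def_field, div_neg_iff] at hx
  rcases hx with hx | hx <;> linarith

theorem IsLocalMax.second_deriv_nonpos {f g : ℝ → ℝ} {a d : ℝ} (hmax : IsLocalMax f a)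
    (hf : ∀ᶠ x in 𝓝 a, HasDerivAt f (g x) x) (hg : HasDerivAt g d a) : d ≤ 0 := by
  by_contra! hd
  have hfa := hf.self_of_nhds
  have hga : g a = 0 := hmax.hasDerivAt_eq_zero hfa
  have hpos : ∀ᶠ x in 𝓝[>] a, 0 < g x := hga ▸ hg.eventually_lt_nhdsGT hd
  obtain ⟨b, hab, hb⟩ := mem_nhdsGT_iff_exists_Ioo_subset.1
    ((hpos.and (mem_nhdsWithin_of_mem_nhds (hf.and hmax))))
  have hab : a < b := hab
  have hmid : (a + b) / 2 ∈ Ioo a b := ⟨by linarith, by linarith⟩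
  have hsub : Icc a ((a + b) / 2) ⊆ insert a (Ioo a b) := fun x hx => by
    rcases eq_or_lt_of_le hx.1 with h | h
    · exact Or.inl h.symm
    · exact Or.inr ⟨h, hx.2.trans_lt hmid.2⟩
  obtain ⟨ξ, hξ, hξe⟩ := exists_hasDerivAt_eq_slope f g hmid.1
    (fun x hx => by
      rcases hsub hx with rfl | h
      · exact hfa.continuousAt.continuousWithinAt
      · exact (hb h).2.1.continuousAt.continuousWithinAt)
    (fun x hx => (hb ⟨hx.1, hx.2.trans hmid.2⟩).2.1)
  have h1 : 0 < g ξ := (hb ⟨hξ.1, hξ.2.trans hmid.2⟩).1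
  have h2 : f ((a + b) / 2) ≤ f a := (hb hmid).2.2
  rw [hξe] at h1
  exact absurd h1 (not_lt.2 (div_nonpos_of_nonpos_of_nonneg (by linarith) (by linarith)))

/-- The space-time domain `{(x,t) : t ∈ [0, t̄], x > x₀(t)}` of the flow. -/
def flowDomain (tb : ℝ) (x₀ : ℝ → ℝ) : Set (ℝ × ℝ) := {p | p.2 ∈ Icc 0 tb ∧ x₀ p.2 < p.1}

/-- The cosine factor `1/√(1+u_x²)`. -/
noncomputable def tilt (u : ℝ → ℝ → ℝ) (x t : ℝ) : ℝ := (√(1 + uX u x t ^ 2))⁻¹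

theorem tilt_pos (u : ℝ → ℝ → ℝ) (x t : ℝ) : 0 < tilt u x t := by
  unfold tilt; positivity

theorem tilt_sq (u : ℝ → ℝ → ℝ) (x t : ℝ) : tilt u x t ^ 2 = (1 + uX u x t ^ 2)⁻¹ := by
  unfold tilt
  rw [inv_pow, Real.sq_sqrt (by positivity)]

theorem tilt_pow_three (u : ℝ → ℝ → ℝ) (x t : ℝ) :
    tilt u x t ^ 3 = ((1 + uX u x t ^ 2) ^ ((3 : ℝ) / 2))⁻¹ := by
  unfold tilt
  rw [inv_pow, Real.sqrt_eq_rpow, ← Real.rpow_natCast, ← Real.rpow_mul (by positivity)]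
  norm_num

theorem tilt_sq_mul (u : ℝ → ℝ → ℝ) (x t : ℝ) : tilt u x t ^ 2 * (1 + uX u x t ^ 2) = 1 := by
  rw [tilt_sq]
  exact inv_mul_cancel₀ (by positivity)

/-- The defect `κ_n - C κ₁`, which is nonpositive exactly where `ℜ ≤ C`. -/
noncomputable def curvGap (C : ℝ) (u : ℝ → ℝ → ℝ) (x t : ℝ) : ℝ :=
  -(uXX u x t * tilt u x t ^ 3) - C * (tilt u x t * (u x t)⁻¹)

theorem curvGap_nonpos_iff {u : ℝ → ℝ → ℝ} {C x t : ℝ} (hu : 0 < u x t) :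
    curvGap C u x t ≤ 0 ↔ ratioR u x t ≤ C := by
  have hs := tilt_pos u x t
  have hR : ratioR u x t = -(u x t) * uXX u x t * tilt u x t ^ 2 := by
    unfold ratioR
    rw [div_eq_iff (by positivity), mul_assoc, tilt_sq_mul, mul_one]
  have hG : curvGap C u x t = (ratioR u x t - C) * (tilt u x t * (u x t)⁻¹) := by
    rw [hR]
    unfold curvGap
    field_simp
  rw [hG, ← sub_nonpos (b := C)]
  exact ⟨fun h => nonpos_of_mul_nonpos_left h (mul_pos hs (inv_pos.2 hu)),
    fun h => mul_nonpos_of_nonpos_of_nonneg h (mul_pos hs (inv_pos.2 hu)).le⟩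

/-- The spatial derivative of `curvGap`. -/
noncomputable def curvGapX (C : ℝ) (u : ℝ → ℝ → ℝ) (x t : ℝ) : ℝ :=
  -(uX (uXX u) x t * tilt u x t ^ 3) + 3 * uX u x t * uXX u x t ^ 2 * tilt u x t ^ 5
    + C * uX u x t * uXX u x t * tilt u x t ^ 3 * (u x t)⁻¹
    + C * uX u x t * tilt u x t * (u x t)⁻¹ ^ 2

/-- The damped defect, lowered by a multiple of a function that is proper near infinity and
near the axis of rotation. -/
noncomputable def gapBarrier (C L ε m : ℝ) (u : ℝ → ℝ → ℝ) (x t : ℝ) : ℝ :=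
  Real.exp (-(L * t)) * curvGap C u x t - ε * ((u x t)⁻¹ + (x - m + 1))

/-- A strictly convex rotationally symmetric graphical mean curvature flow whose principal
curvatures are at most `K`. -/
structure ConvexFlow (N tb K : ℝ) (x₀ : ℝ → ℝ) (u : ℝ → ℝ → ℝ) : Prop where
  one_le : 1 ≤ N
  smooth : ContDiffOn ℝ ∞ (Function.uncurry u) (flowDomain tb x₀)
  pos : ∀ {x t}, (x, t) ∈ flowDomain tb x₀ → 0 < u x t
  tip : ∀ {t}, t ∈ Icc 0 tb → Tendsto (fun x => u x t) (𝓝[>] (x₀ t)) (𝓝 0)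
  uX_pos : ∀ {x t}, (x, t) ∈ flowDomain tb x₀ → 0 < uX u x t
  uXX_neg : ∀ {x t}, (x, t) ∈ flowDomain tb x₀ → uXX u x t < 0
  pde : ∀ {x t}, (x, t) ∈ flowDomain tb x₀ →
    uT u x t = uXX u x t * tilt u x t ^ 2 - N * (u x t)⁻¹
  radial_curv_le : ∀ {x t}, (x, t) ∈ flowDomain tb x₀ → tilt u x t * (u x t)⁻¹ ≤ K
  axial_curv_le : ∀ {x t}, (x, t) ∈ flowDomain tb x₀ → -uXX u x t * tilt u x t ^ 3 ≤ K

namespace ConvexFlow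

variable {N tb K : ℝ} {x₀ : ℝ → ℝ} {u : ℝ → ℝ → ℝ}

theorem eventually_slice {z : ℝ × ℝ} (hz : z ∈ flowDomain tb x₀) :
    ∀ᶠ y in 𝓝 z.1, (y, z.2) ∈ flowDomain tb x₀ := by
  filter_upwards [Ioi_mem_nhds hz.2] with y hy using ⟨hz.1, hy⟩

theorem _root_.ContinuousOn.continuousWithinAt_time_slice {g : ℝ → ℝ → ℝ}
    (hg : ContinuousOn (Function.uncurry g) (flowDomain tb x₀)) {x t : ℝ}
    (hx : (x, t) ∈ flowDomain tb x₀) :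
    ContinuousWithinAt (fun s => g x s) {s | (x, s) ∈ flowDomain tb x₀} t :=
  ContinuousWithinAt.comp (g := Function.uncurry g) (f := fun s => (x, s)) (hg (x, t) hx)
    (Continuous.prodMk_right x).continuousWithinAt fun _ hs => hs

theorem flowDomain_mem_nhds {x t : ℝ} (ht : t ∈ Ioo 0 tb) (hx : x₀ t < x)
    (hreg : ∀ y, x₀ t < y → ∀ᶠ σ in 𝓝[Icc 0 tb] t, x₀ σ < y) :
    flowDomain tb x₀ ∈ 𝓝 (x, t) := by
  obtain ⟨y, hty, hyx⟩ := exists_between hx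
  have h1 := eventually_nhdsWithin_iff.1 (hreg y hty)
  have h2 : ∀ᶠ s in 𝓝 t, s ∈ Icc 0 tb ∧ x₀ s < y := by
    filter_upwards [h1, Icc_mem_nhds ht.1 ht.2] with s hs hsI using ⟨hsI, hs hsI⟩
  rw [nhds_prod_eq]
  filter_upwards [prod_mem_prod (Ioi_mem_nhds hyx) h2] with z hz
  exact ⟨hz.2.1, hz.2.2.trans hz.1⟩

theorem smooth_uX (h : ConvexFlow N tb K x₀ u)
    : ContDiffOn ℝ ∞ (Function.uncurry (uX u)) (flowDomain tb x₀) :=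
  h.smooth.uncurry_uX fun _ => eventually_slice

theorem smooth_uXX (h : ConvexFlow N tb K x₀ u)
    : ContDiffOn ℝ ∞ (Function.uncurry (uXX u)) (flowDomain tb x₀) :=
  h.smooth_uX.uncurry_uX fun _ => eventually_slice

theorem hasDerivAt_u (h : ConvexFlow N tb K x₀ u) {x t : ℝ} (hx : (x, t) ∈ flowDomain tb x₀) :
    HasDerivAt (fun y => u y t) (uX u x t) x :=
  h.smooth.hasDerivAt_uX hx (eventually_slice hx)

theorem hasDerivAt_uX (h : ConvexFlow N tb K x₀ u) {x t : ℝ} (hx : (x, t) ∈ flowDomain tb x₀) :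
    HasDerivAt (fun y => uX u y t) (uXX u x t) x :=
  h.smooth_uX.hasDerivAt_uX hx (eventually_slice hx)

theorem strictMonoOn (h : ConvexFlow N tb K x₀ u)
    {t : ℝ} (ht : t ∈ Icc 0 tb) : StrictMonoOn (fun x => u x t) (Ioi (x₀ t)) :=
  strictMonoOn_of_deriv_pos (convex_Ioi _)
    (fun _ hx => (h.hasDerivAt_u ⟨ht, hx⟩).continuousAt.continuousWithinAt)
    fun _ hx => h.uX_pos ⟨ht, interior_subset hx⟩

theorem strictAntiOn_uX (h : ConvexFlow N tb K x₀ u) {t : ℝ} (ht : t ∈ Icc 0 tb) :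
    StrictAntiOn (fun x => uX u x t) (Ioi (x₀ t)) :=
  strictAntiOn_of_deriv_neg (convex_Ioi _)
    (fun _ hx => (h.hasDerivAt_uX ⟨ht, hx⟩).continuousAt.continuousWithinAt)
    fun _ hx => h.uXX_neg ⟨ht, interior_subset hx⟩

theorem uX_mul_sub_lt (h : ConvexFlow N tb K x₀ u)
    {t x z : ℝ} (ht : t ∈ Icc 0 tb) (hz : x₀ t < z) (hzx : z < x) :
    uX u x t * (x - z) < u x t := by
  obtain ⟨ξ, hξ, he⟩ := exists_hasDerivAt_eq_slope (fun y => u y t) (fun y => uX u y t) hzx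
    (fun y hy => (h.hasDerivAt_u ⟨ht, hz.trans_le hy.1⟩).continuousAt.continuousWithinAt)
    (fun y hy => h.hasDerivAt_u ⟨ht, hz.trans hy.1⟩)
  have h1 := h.strictAntiOn_uX ht (hz.trans hξ.1) (hz.trans hzx) hξ.2
  have h2 := h.pos (x := z) ⟨ht, hz⟩
  simp only at h1
  rw [he, lt_div_iff₀ (by linarith)] at h1
  linarith

theorem lowerSemicontinuousOn_tip (h : ConvexFlow N tb K x₀ u)
    : LowerSemicontinuousOn x₀ (Icc 0 tb) := by
  intro t ht a ha
  have ha : a < x₀ t := ha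
  obtain ⟨z, haz, hzt⟩ := exists_between ha
  have hp0 := h.uX_pos (x := x₀ t + 1) ⟨ht, by simp⟩
  have hd : 0 < uX u (x₀ t + 1) t * (x₀ t - z) := mul_pos hp0 (by linarith)
  obtain ⟨x, hux, hx, hx1⟩ := (((h.tip ht).eventually_lt_const hd).and
    (Ioo_mem_nhdsGT (show x₀ t < x₀ t + 1 by linarith))).exists
  have hxd : (x, t) ∈ flowDomain tb x₀ := ⟨ht, hx⟩
  have hp := h.strictAntiOn_uX ht hx (show x₀ t < x₀ t + 1 by linarith) hx1
  have hcont := (ContinuousOn.continuousWithinAt_time_slice (g := u) h.smooth.continuousOn hxd).sub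
    ((ContinuousOn.continuousWithinAt_time_slice (g := uX u) h.smooth_uX.continuousOn hxd).mul_const
      (x₀ t - z))
  have hneg : u x t - uX u x t * (x₀ t - z) < 0 := by
    have := mul_lt_mul_of_pos_right hp (sub_pos.2 hzt)
    simp only at this
    linarith
  have hev := eventually_nhdsWithin_iff.1 (hcont.eventually_lt_const hneg)
  filter_upwards [self_mem_nhdsWithin, mem_nhdsWithin_of_mem_nhds hev] with s hs hsx
  by_contra! hsa
  have h1 := hsx ⟨hs, by simp only; linarith⟩
  have h2 := h.uX_mul_sub_lt hs (hsa.trans_lt haz) (hzt.trans hx)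
  have h3 := h.uX_pos (x := x) (t := s) ⟨hs, by simp only; linarith⟩
  have h4 := mul_lt_mul_of_pos_left (show x₀ t - z < x - z by linarith) h3
  simp only [Pi.sub_apply] at h1
  linarith

theorem isClosed_superlevel (h : ConvexFlow N tb K x₀ u) {c : ℝ} (hc : 0 < c) :
    IsClosed {z | z ∈ flowDomain tb x₀ ∧ c ≤ u z.1 z.2} := by
  refine isClosed_of_closure_subset ?_
  rintro ⟨x, t⟩ hz
  have ht : t ∈ Icc 0 tb := by
    have hcl : IsClosed {z : ℝ × ℝ | z.2 ∈ Icc 0 tb} := isClosed_Icc.preimage continuous_snd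
    exact closure_minimal (fun z hz => hz.1.1) hcl hz
  rw [mem_closure_iff_frequently] at hz
  have hfst : Tendsto Prod.fst (𝓝 (x, t)) (𝓝 x) := continuousAt_fst
  have hsnd : Tendsto Prod.snd (𝓝 (x, t)) (𝓝 t) := continuousAt_snd
  have hle : x₀ t ≤ x := by
    by_contra! hlt
    obtain ⟨a, hxa, hat⟩ := exists_between hlt
    have h1 := hsnd.eventually
      (eventually_nhdsWithin_iff.1 (h.lowerSemicontinuousOn_tip t ht a hat))
    obtain ⟨z, ⟨⟨hzI, hz0⟩, -⟩, hz1, hz2⟩ :=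
      (hz.and_eventually (h1.and (hfst.eventually_lt_const hxa))).exists
    linarith [hz1 hzI]
  have hlt : x₀ t < x := by
    refine lt_of_le_of_ne hle fun he => ?_
    obtain ⟨y, huy, hy⟩ := (((h.tip ht).eventually_lt_const hc).and self_mem_nhdsWithin).exists
    have hy : x₀ t < y := hy
    have hcont := ContinuousOn.continuousWithinAt_time_slice (g := u) (x := y)
      h.smooth.continuousOn ⟨ht, hy⟩
    have h1 := hsnd.eventually (eventually_nhdsWithin_iff.1 (hcont.eventually_lt_const huy))
    obtain ⟨z, ⟨⟨hzI, hz0⟩, hzc⟩, hz1, hz2⟩ :=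
      (hz.and_eventually (h1.and (hfst.eventually_lt_const (he ▸ hy)))).exists
    have h2 := hz1 ⟨hzI, hz0.trans hz2⟩
    have h3 := h.strictMonoOn hzI hz0 (hz0.trans hz2) hz2
    simp only at h3
    linarith
  refine ⟨⟨ht, hlt⟩, ?_⟩
  by_contra! hcu
  have h1 := eventually_nhdsWithin_iff.1
    ((h.smooth.continuousOn (x, t) ⟨ht, hlt⟩).eventually_lt_const hcu)
  obtain ⟨z, ⟨hzd, hzc⟩, hz1⟩ := (hz.and_eventually h1).exists
  exact absurd (hz1 hzd) (not_lt.2 hzc)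

theorem hasDerivAt_tilt (h : ConvexFlow N tb K x₀ u) {x t : ℝ} (hx : (x, t) ∈ flowDomain tb x₀) :
    HasDerivAt (fun y => tilt u y t) (-(uX u x t * uXX u x t * tilt u x t ^ 3)) x := by
  have h0 : (0 : ℝ) < 1 + uX u x t ^ 2 := by positivity
  have hs : 0 < √(1 + uX u x t ^ 2) := Real.sqrt_pos.2 h0
  refine ((((h.hasDerivAt_uX hx).pow 2).const_add 1).sqrt h0.ne' |>.inv hs.ne').congr_deriv ?_
  simp only [tilt]
  generalize √(1 + uX u x t ^ 2) = r at hs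
  field_simp
  simp only [Nat.cast_ofNat, Nat.add_one_sub_one, pow_one]
  ring

theorem hasDerivAt_sin (h : ConvexFlow N tb K x₀ u) {x t : ℝ} (hx : (x, t) ∈ flowDomain tb x₀) :
    HasDerivAt (fun y => uX u y t * tilt u y t) (uXX u x t * tilt u x t ^ 3) x := by
  refine ((h.hasDerivAt_uX hx).mul (h.hasDerivAt_tilt hx)).congr_deriv ?_
  linear_combination (-(uXX u x t * tilt u x t)) * tilt_sq_mul u x t

theorem curv_bound_pos (h : ConvexFlow N tb K x₀ u)
    {x t : ℝ} (hx : (x, t) ∈ flowDomain tb x₀) : 0 < K :=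
  (mul_pos (tilt_pos u x t) (inv_pos.2 (h.pos hx))).trans_le (h.radial_curv_le hx)

theorem one_sub_le_sin (h : ConvexFlow N tb K x₀ u) {x t : ℝ} (hx : (x, t) ∈ flowDomain tb x₀) :
    1 - K * (x - x₀ t) ≤ uX u x t * tilt u x t := by
  have hK := h.curv_bound_pos hx
  have hlim : Tendsto (fun z => 1 - (K * u z t) ^ 2 - K * (x - z)) (𝓝[>] (x₀ t))
      (𝓝 (1 - (K * 0) ^ 2 - K * (x - x₀ t))) := by
    refine (tendsto_const_nhds.sub (((h.tip hx.1).const_mul K).pow 2)).sub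
      (Tendsto.const_mul K (tendsto_const_nhds.sub ?_))
    exact tendsto_nhdsWithin_of_tendsto_nhds tendsto_id
  have h0 : 1 - K * (x - x₀ t) = 1 - (K * 0) ^ 2 - K * (x - x₀ t) := by ring
  rw [h0]
  refine le_of_tendsto hlim ?_
  filter_upwards [Ioo_mem_nhdsGT hx.2] with z hz
  have hzd : (z, t) ∈ flowDomain tb x₀ := ⟨hx.1, hz.1⟩
  obtain ⟨ξ, hξ, he⟩ := exists_hasDerivAt_eq_slope (fun y => uX u y t * tilt u y t)
    (fun y => uXX u y t * tilt u y t ^ 3) hz.2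
    (fun y hy => (h.hasDerivAt_sin (x := y) ⟨hx.1, lt_of_lt_of_le hz.1 hy.1⟩)
      |>.continuousAt.continuousWithinAt)
    (fun y hy => h.hasDerivAt_sin (x := y) ⟨hx.1, lt_trans hz.1 hy.1⟩)
  have h1 := h.axial_curv_le (x := ξ) (t := t) ⟨hx.1, hz.1.trans hξ.1⟩
  have h2 : -K ≤ uXX u ξ t * tilt u ξ t ^ 3 := by linarith
  rw [he, le_div_iff₀ (sub_pos.2 hz.2)] at h2
  have hs := tilt_pos u z t
  have hp := h.uX_pos hzd
  have h3 : tilt u z t ≤ K * u z t := by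
    have := h.radial_curv_le hzd
    rwa [← div_eq_mul_inv, div_le_iff₀ (h.pos hzd)] at this
  have h4 : tilt u z t ^ 2 ≤ (K * u z t) ^ 2 := by gcongr
  have h5 := tilt_sq_mul u z t
  have h6 : (uX u z t * tilt u z t) ^ 2 ≤ uX u z t * tilt u z t := by
    have : uX u z t * tilt u z t ≤ 1 := by
      rw [← abs_of_pos (mul_pos hp hs), ← sq_le_one_iff_abs_le_one]
      nlinarith
    nlinarith [mul_pos hp hs]
  nlinarith

theorem continuousOn_tilt (h : ConvexFlow N tb K x₀ u)
    : ContinuousOn (Function.uncurry (tilt u)) (flowDomain tb x₀) :=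
  ((continuousOn_const.add (h.smooth_uX.continuousOn.pow 2)).sqrt).inv₀ fun _ _ =>
    (Real.sqrt_pos.2 (add_pos_of_pos_of_nonneg one_pos (sq_nonneg _))).ne'

theorem tip_jump_dichotomy (h : ConvexFlow N tb K x₀ u)
    {t : ℝ} (ht : t ∈ Icc 0 tb) {y : ℝ} (hy : x₀ t < y) (M : ℝ) :
    ∀ᶠ s in 𝓝[Icc 0 tb] t, x₀ s < y ∨ M < x₀ s := by
  by_contra hcon
  have hfreq : ∃ᶠ s in 𝓝[Icc 0 tb] t, x₀ s ∈ Icc y M := by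
    refine (not_eventually.1 hcon).mono fun s hs => ?_
    push Not at hs
    exact hs
  obtain ⟨c, hc, hclus⟩ := isCompact_Icc.exists_mapClusterPt_of_frequently hfreq
  have htc : x₀ t < c := hy.trans_le hc.1
  have hcd : (c, t) ∈ flowDomain tb x₀ := ⟨ht, htc⟩
  have hK := h.curv_bound_pos hcd
  have hsin : uX u c t * tilt u c t < 1 := by
    have h1 := mul_pos (h.uX_pos hcd) (tilt_pos u c t)
    have h2 := tilt_sq_mul u c t
    nlinarith [pow_pos (tilt_pos u c t) 2]
  have hev : ∀ᶠ x in 𝓝[>] c, uX u x t * tilt u x t < 1 - 2 * K * (x - c) := by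
    refine mem_nhdsWithin_of_mem_nhds ?_
    refine (h.hasDerivAt_sin hcd).continuousAt.eventually_lt
      (g := fun x => 1 - 2 * K * (x - c)) (by fun_prop) (by simpa using hsin)
  obtain ⟨x, hx, hcx⟩ := (hev.and self_mem_nhdsWithin).exists
  have hcx : c < x := hcx
  have hxd : (x, t) ∈ flowDomain tb x₀ := ⟨ht, htc.trans hcx⟩
  have hcont := ContinuousOn.continuousWithinAt_time_slice
    (g := fun x s => uX u x s * tilt u x s)
    (h.smooth_uX.continuousOn.mul h.continuousOn_tilt) hxd
  have hev2 := eventually_nhdsWithin_iff.1 (hcont.eventually_lt_const hx)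
  obtain ⟨s, hs, hs2, hsI⟩ := ((hclus.frequently
    (Ioo_mem_nhds (show c - (x - c) < c by linarith) hcx)).and_eventually
      (Eventually.and (mem_nhdsWithin_of_mem_nhds hev2) self_mem_nhdsWithin)).exists
  have hsd : (x, s) ∈ flowDomain tb x₀ := ⟨hsI, hs.2⟩
  have h1 := hs2 hsd
  have h2 := h.one_sub_le_sin hsd
  nlinarith [hs.1]

theorem uT_neg (h : ConvexFlow N tb K x₀ u)
    {x t : ℝ} (hx : (x, t) ∈ flowDomain tb x₀) : uT u x t < 0 := by
  rw [h.pde hx]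
  have h1 := mul_neg_of_neg_of_pos (h.uXX_neg hx) (pow_pos (tilt_pos u x t) 2)
  have h2 := mul_pos (zero_lt_one.trans_le h.one_le) (inv_pos.2 (h.pos hx))
  linarith

theorem hasDerivAt_time (h : ConvexFlow N tb K x₀ u) {x t : ℝ} (hx : (x, t) ∈ flowDomain tb x₀) :
    HasDerivAt (fun s => u x s) (uT u x t) t :=
  (differentiableAt_of_deriv_ne_zero (h.uT_neg hx).ne).hasDerivAt

theorem tip_le_of_regular (h : ConvexFlow N tb K x₀ u)
    {a b : ℝ} (ha : 0 ≤ a) (hb : b ≤ tb) (hab : a ≤ b)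
    (hreg : ∀ τ ∈ Ioc a b, ∀ y, x₀ τ < y → ∀ᶠ σ in 𝓝[Icc 0 tb] τ, x₀ σ < y) :
    x₀ a ≤ x₀ b := by
  by_contra! hlt
  obtain ⟨y, hby, hya⟩ := exists_between hlt
  have hbd : (y, b) ∈ flowDomain tb x₀ := ⟨⟨ha.trans hab, hb⟩, hby⟩
  have hA : IsCompact (Icc a b ∩ (fun τ => (y, τ)) ⁻¹'
      {z | z ∈ flowDomain tb x₀ ∧ u y b ≤ u z.1 z.2}) :=
    isCompact_Icc.inter_right
      ((h.isClosed_superlevel (h.pos hbd)).preimage (Continuous.prodMk_right y))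
  obtain ⟨τ, ⟨hτI, hτd, hτu⟩, hmin⟩ := hA.exists_isLeast ⟨b, ⟨hab, le_rfl⟩, hbd, le_rfl⟩
  rcases eq_or_lt_of_le hτI.1 with he | hlt'
  · exact absurd hτd.2 (not_lt.2 (by simpa only [← he] using hya.le))
  · have h1 := (h.hasDerivAt_time hτd).eventually_gt_nhdsLT (h.uT_neg hτd)
    have h2 : ∀ᶠ σ in 𝓝[<] τ, σ ∈ Icc 0 tb → x₀ σ < y :=
      (eventually_nhdsWithin_iff.1 (hreg τ ⟨hlt', hτI.2⟩ y hτd.2)).filter_mono nhdsWithin_le_nhds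
    obtain ⟨σ, hσu, hσ, hσI⟩ :=
      (h1.and (Eventually.and h2 (Ioo_mem_nhdsLT hlt'))).exists
    have hσ0 : σ ∈ Icc 0 tb := ⟨ha.trans hσI.1.le, hσI.2.le.trans hτd.1.2⟩
    have := hmin ⟨⟨hσI.1.le, hσI.2.le.trans hτI.2⟩, ⟨hσ0, hσ hσ0⟩, hτu.trans hσu.le⟩
    exact absurd this (not_le.2 hσI.2)

theorem contDiffAt (h : ConvexFlow N tb K x₀ u) {x t : ℝ} (hx : flowDomain tb x₀ ∈ 𝓝 (x, t)) :
    ContDiffAt ℝ ∞ (Function.uncurry u) (x, t) :=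
  h.smooth.contDiffAt hx

theorem neg_uT_lt (h : ConvexFlow N tb K x₀ u)
    {x t : ℝ} (hx : (x, t) ∈ flowDomain tb x₀) (hp : 1 ≤ uX u x t) :
    -uT u x t < (2 * (N + 1) * K + 1) * uX u x t := by
  have hN := h.one_le
  have hK := h.curv_bound_pos hx
  have hs := tilt_pos u x t
  have h1 := h.radial_curv_le hx
  have h2 := h.axial_curv_le hx
  have h3 := tilt_sq_mul u x t
  have h5 : -uT u x t * tilt u x t ≤ (N + 1) * K := by
    rw [h.pde hx]
    nlinarith
  have h6 : 1 ≤ 2 * uX u x t * tilt u x t := by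
    have hps := mul_pos (zero_lt_one.trans_le hp) hs
    nlinarith
  have h7 : -uT u x t * tilt u x t < (2 * (N + 1) * K + 1) * uX u x t * tilt u x t := by
    have : (N + 1) * K * 1 ≤ (N + 1) * K * (2 * uX u x t * tilt u x t) := by gcongr
    nlinarith [mul_pos (zero_lt_one.trans_le hp) hs]
  exact lt_of_mul_lt_mul_right h7 hs.le

theorem lt_u_of_uX_lt_one (h : ConvexFlow N tb K x₀ u)
    {x t : ℝ} (hx : (x, t) ∈ flowDomain tb x₀) (hp : uX u x t < 1) :
    1 / (2 * K) < u x t := by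
  have hK := h.curv_bound_pos hx
  have hu := h.pos hx
  have hs := tilt_pos u x t
  have h0 := h.uX_pos hx
  have h1 : tilt u x t ≤ K * u x t := by
    have := h.radial_curv_le hx
    rwa [← div_eq_mul_inv, div_le_iff₀ hu] at this
  have h2 : 1 / 2 < tilt u x t := by
    have h3 := tilt_sq_mul u x t
    have h4 : uX u x t ^ 2 < 1 := by nlinarith
    by_contra! h5
    have h6 : tilt u x t ^ 2 ≤ (1 / 2) ^ 2 := by gcongr
    nlinarith [mul_pos hs hs]
  rw [div_lt_iff₀ (by positivity)]
  linarith

theorem tip_le_add_of_regular (h : ConvexFlow N tb K x₀ u)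
    {a b : ℝ} (ha : 0 < a) (hb : b ≤ tb) (hab : a ≤ b)
    (hreg : ∀ τ ∈ Ico a b, ∀ y, x₀ τ < y → ∀ᶠ σ in 𝓝[Icc 0 tb] τ, x₀ σ < y) :
    x₀ b ≤ x₀ a + 1 + (2 * (N + 1) * K + 1) * (b - a) := by
  set L := 2 * (N + 1) * K + 1 with hL
  have had : (x₀ a + 1 + L * (a - a), a) ∈ flowDomain tb x₀ := ⟨⟨ha.le, hab.trans hb⟩, by simp⟩
  have hK := h.curv_bound_pos had
  set c := min (u (x₀ a + 1 + L * (a - a)) a) (1 / (2 * K)) with hc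
  have hc0 : 0 < c := lt_min (h.pos had) (by positivity)
  have hcurve : Continuous fun τ : ℝ => (x₀ a + 1 + L * (τ - a), τ) := by fun_prop
  have hA : IsCompact (Icc a b ∩ (fun τ => (x₀ a + 1 + L * (τ - a), τ)) ⁻¹'
      {z | z ∈ flowDomain tb x₀ ∧ c ≤ u z.1 z.2}) :=
    isCompact_Icc.inter_right ((h.isClosed_superlevel hc0).preimage hcurve)
  obtain ⟨τ, ⟨hτI, hτd, hτu⟩, hmax⟩ :=
    hA.exists_isGreatest ⟨a, ⟨le_rfl, hab⟩, had, min_le_left _ _⟩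
  rcases eq_or_lt_of_le hτI.2 with he | hlt
  · rw [← he]
    exact hτd.2.le
  · exfalso
    have hnhds := flowDomain_mem_nhds (tb := tb) ⟨ha.trans_le hτI.1, hlt.trans_le hb⟩ hτd.2
      (hreg τ ⟨hτI.1, hlt⟩)
    have hdiff := (h.contDiffAt hnhds).differentiableAt (by simp)
    have hderiv : HasDerivAt (fun σ => u (x₀ a + 1 + L * (σ - a)) σ)
        (L * uX u (x₀ a + 1 + L * (τ - a)) τ + uT u (x₀ a + 1 + L * (τ - a)) τ) τ := by
      have hy : HasDerivAt (fun σ : ℝ => x₀ a + 1 + L * (σ - a)) L τ := by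
        simpa using (((hasDerivAt_id τ).sub_const a).const_mul L).const_add (x₀ a + 1)
      have := HasFDerivAt.comp_hasDerivAt (f := fun σ => (x₀ a + 1 + L * (σ - a), σ)) τ
        hdiff.hasFDerivAt (hy.prodMk (hasDerivAt_id τ))
      refine this.congr_deriv ?_
      rw [hdiff.fderiv_uncurry_apply]
      simp
    have hev : ∀ᶠ σ in 𝓝[>] τ, c ≤ u (x₀ a + 1 + L * (σ - a)) σ := by
      rcases le_or_gt 1 (uX u (x₀ a + 1 + L * (τ - a)) τ) with hp | hp
      · have h1 := h.neg_uT_lt hτd hp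
        filter_upwards [hderiv.eventually_lt_nhdsGT (by linarith)] with σ hσ
        exact hτu.trans hσ.le
      · have h1 : c < _ := (min_le_right _ _).trans_lt (h.lt_u_of_uX_lt_one hτd hp)
        exact mem_nhdsWithin_of_mem_nhds
          ((hderiv.continuousAt.eventually_const_lt h1).mono fun _ hσ => hσ.le)
    obtain ⟨σ, hσu, hσd, hσ⟩ := (hev.and (Eventually.and
      (mem_nhdsWithin_of_mem_nhds (hcurve.continuousAt.eventually hnhds))
      (Ioo_mem_nhdsGT hlt))).exists
    have := hmax ⟨⟨hτI.1.trans hσ.1.le, hσ.2.le⟩, hσd, hσu⟩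
    exact absurd this (not_le.2 hσ.1)

/-- The tip position of the flow is upper semicontinuous in time. -/
theorem eventually_tip_lt (h : ConvexFlow N tb K x₀ u)
    {t : ℝ} (ht : t ∈ Icc 0 tb) {y : ℝ} (hy : x₀ t < y) :
    ∀ᶠ s in 𝓝[Icc 0 tb] t, x₀ s < y := by
  refine eventually_lt_of_jump_dichotomy (D := 2 + (2 * (N + 1) * K + 1) * tb)
    h.lowerSemicontinuousOn_tip (fun t ht y hy M => h.tip_jump_dichotomy ht hy M) ?_ t ht y hy
  intro r hr s hs hrs hreg
  have hev : ∀ᶠ σ in 𝓝[>] r, σ ∈ Icc 0 tb → x₀ σ < x₀ r + 1 ∨ x₀ s < x₀ σ :=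
    (eventually_nhdsWithin_iff.1 (h.tip_jump_dichotomy hr (lt_add_one (x₀ r)) (x₀ s))).filter_mono
      nhdsWithin_le_nhds
  obtain ⟨σ, hσ, hσI⟩ := (hev.and (Ioo_mem_nhdsGT hrs)).exists
  have hle := h.tip_le_of_regular (hr.1.trans hσI.1.le) hs.2 hσI.2.le fun τ hτ =>
    hreg τ ⟨hσI.1.trans hτ.1, hτ.2⟩
  have h1 := (hσ ⟨hr.1.trans hσI.1.le, hσI.2.le.trans hs.2⟩).resolve_right (not_lt.2 hle)
  have h2 := h.tip_le_add_of_regular (hr.1.trans_lt hσI.1) hs.2 hσI.2.le fun τ hτ =>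
    hreg τ ⟨hσI.1.trans_le hτ.1, hτ.2.le⟩
  have hN := h.one_le
  have hK := h.curv_bound_pos (x := x₀ r + 1) (t := r) ⟨hr, lt_add_one _⟩
  have h3 : (2 * (N + 1) * K + 1) * (s - σ) ≤ (2 * (N + 1) * K + 1) * tb := by
    gcongr
    linarith [hs.2, hr.1, hσI.1]
  linarith


theorem hasDerivAt_uXX (h : ConvexFlow N tb K x₀ u) {x t : ℝ} (hx : (x, t) ∈ flowDomain tb x₀) :
    HasDerivAt (fun y => uXX u y t) (uX (uXX u) x t) x :=
  h.smooth_uXX.hasDerivAt_uX hx (eventually_slice hx)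

theorem hasDerivAt_uXXX (h : ConvexFlow N tb K x₀ u) {x t : ℝ} (hx : (x, t) ∈ flowDomain tb x₀) :
    HasDerivAt (fun y => uX (uXX u) y t) (uX (uX (uXX u)) x t) x :=
  (h.smooth_uXX.uncurry_uX fun _ => eventually_slice).hasDerivAt_uX hx (eventually_slice hx)

theorem hasDerivAt_inv_u (h : ConvexFlow N tb K x₀ u) {x t : ℝ} (hx : (x, t) ∈ flowDomain tb x₀) :
    HasDerivAt (fun y => (u y t)⁻¹) (-(uX u x t * (u x t)⁻¹ ^ 2)) x := by
  refine ((h.hasDerivAt_u hx).inv (h.pos hx).ne').congr_deriv ?_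
  rw [inv_pow, ← div_eq_mul_inv, neg_div]

theorem hasDerivAt_inv_uX (h : ConvexFlow N tb K x₀ u) {x t : ℝ} (hx : (x, t) ∈ flowDomain tb x₀) :
    HasDerivAt (fun y => -(uX u y t * (u y t)⁻¹ ^ 2))
      (2 * uX u x t ^ 2 * (u x t)⁻¹ ^ 3 - uXX u x t * (u x t)⁻¹ ^ 2) x := by
  refine ((h.hasDerivAt_uX hx).mul ((h.hasDerivAt_inv_u hx).pow 2)).neg.congr_deriv ?_
  simp only [Pi.pow_apply, Nat.cast_ofNat]
  ring

theorem hasDerivAt_inv_u_time (h : ConvexFlow N tb K x₀ u)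
    {x t : ℝ} (hx : (x, t) ∈ flowDomain tb x₀) :
    HasDerivAt (fun s => (u x s)⁻¹)
      (N * (u x t)⁻¹ ^ 3 - uXX u x t * tilt u x t ^ 2 * (u x t)⁻¹ ^ 2) t := by
  refine ((h.hasDerivAt_time hx).inv (h.pos hx).ne').congr_deriv ?_
  rw [h.pde hx, div_eq_mul_inv, ← inv_pow]
  ring

theorem hasDerivAt_uT (h : ConvexFlow N tb K x₀ u) {x t : ℝ} (hx : (x, t) ∈ flowDomain tb x₀) :
    HasDerivAt (fun y => uT u y t)
      (uX (uXX u) x t * tilt u x t ^ 2 - 2 * uX u x t * uXX u x t ^ 2 * tilt u x t ^ 4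
        + N * uX u x t * (u x t)⁻¹ ^ 2) x := by
  have h1 := ((h.hasDerivAt_uXX hx).mul ((h.hasDerivAt_tilt hx).pow 2)).sub
    ((h.hasDerivAt_inv_u hx).const_mul N)
  refine (h1.congr_of_eventuallyEq ?_).congr_deriv ?_
  · filter_upwards [eventually_slice hx] with y hy
    simpa using h.pde hy
  · simp only [Pi.pow_apply, Nat.cast_ofNat]
    ring

theorem hasDerivAt_uX_time (h : ConvexFlow N tb K x₀ u)
    {x t : ℝ} (hx : flowDomain tb x₀ ∈ 𝓝 (x, t)) :
    HasDerivAt (fun s => uX u x s)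
      (uX (uXX u) x t * tilt u x t ^ 2 - 2 * uX u x t * uXX u x t ^ 2 * tilt u x t ^ 4
        + N * uX u x t * (u x t)⁻¹ ^ 2) t := by
  have h1 := (contDiffAt_infty.1 (h.contDiffAt hx) 2).hasDerivAt_uX_time
  rwa [(h.hasDerivAt_uT (mem_of_mem_nhds hx)).deriv] at h1

theorem hasDerivAt_tilt_time (h : ConvexFlow N tb K x₀ u)
    {x t : ℝ} (hx : flowDomain tb x₀ ∈ 𝓝 (x, t)) :
    HasDerivAt (fun s => tilt u x s)
      (-(uX u x t * (uX (uXX u) x t * tilt u x t ^ 2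
        - 2 * uX u x t * uXX u x t ^ 2 * tilt u x t ^ 4
        + N * uX u x t * (u x t)⁻¹ ^ 2) * tilt u x t ^ 3)) t := by
  have h0 : (0 : ℝ) < 1 + uX u x t ^ 2 := by positivity
  have hs : 0 < √(1 + uX u x t ^ 2) := Real.sqrt_pos.2 h0
  have hd := h.hasDerivAt_uX_time hx
  generalize uX (uXX u) x t * tilt u x t ^ 2 - 2 * uX u x t * uXX u x t ^ 2 * tilt u x t ^ 4
        + N * uX u x t * (u x t)⁻¹ ^ 2 = p' at hd ⊢
  refine (((hd.pow 2).const_add 1).sqrt h0.ne' |>.inv hs.ne').congr_deriv ?_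
  simp only [tilt]
  generalize √(1 + uX u x t ^ 2) = r at hs
  field_simp
  simp only [Nat.cast_ofNat, Nat.add_one_sub_one, pow_one]
  ring

theorem hasDerivAt_uXX_time (h : ConvexFlow N tb K x₀ u)
    {x t : ℝ} (hx : flowDomain tb x₀ ∈ 𝓝 (x, t)) :
    HasDerivAt (fun s => uXX u x s)
      (-2 * uXX u x t ^ 3 * tilt u x t ^ 4 + N * uXX u x t * (u x t)⁻¹ ^ 2
        - 6 * uX u x t * uXX u x t * uX (uXX u) x t * tilt u x t ^ 4
        + uX (uX (uXX u)) x t * tilt u x t ^ 2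
        + 8 * uX u x t ^ 2 * uXX u x t ^ 3 * tilt u x t ^ 6
        - 2 * N * uX u x t ^ 2 * (u x t)⁻¹ ^ 3) t := by
  have hxd := mem_of_mem_nhds hx
  have h1 := (contDiffAt_infty.1 (h.smooth_uX.contDiffAt hx) 2).hasDerivAt_uX_time
  have h2 := (((h.hasDerivAt_uXXX hxd).mul ((h.hasDerivAt_tilt hxd).pow 2)).sub
    ((((h.hasDerivAt_uX hxd).const_mul 2).mul ((h.hasDerivAt_uXX hxd).pow 2)).mul
      ((h.hasDerivAt_tilt hxd).pow 4))).add
    (((h.hasDerivAt_uX hxd).const_mul N).mul ((h.hasDerivAt_inv_u hxd).pow 2))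
  have h3 := h2.congr_of_eventuallyEq (f₁ := fun y => uT (uX u) y t) <| by
    filter_upwards [(Continuous.prodMk_left t).tendsto x |>.eventually
      (eventually_mem_nhds_iff.2 hx)] with y hy
    exact (h.hasDerivAt_uX_time hy).deriv
  rw [h3.deriv] at h1
  refine h1.congr_deriv ?_
  simp only [Pi.pow_apply, Pi.mul_apply, Nat.cast_ofNat]
  ring

theorem hasDerivAt_curvGap (h : ConvexFlow N tb K x₀ u)
    (C : ℝ) {x t : ℝ} (hx : (x, t) ∈ flowDomain tb x₀) :
    HasDerivAt (fun y => curvGap C u y t) (curvGapX C u x t) x := by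
  refine (((h.hasDerivAt_uXX hx).mul ((h.hasDerivAt_tilt hx).pow 3)).neg.sub
    (((h.hasDerivAt_tilt hx).mul (h.hasDerivAt_inv_u hx)).const_mul C)).congr_deriv ?_
  simp only [curvGapX, Pi.pow_apply, Nat.cast_ofNat]
  ring

theorem hasDerivAt_curvGapX (h : ConvexFlow N tb K x₀ u)
    (C : ℝ) {x t : ℝ} (hx : (x, t) ∈ flowDomain tb x₀) :
    HasDerivAt (fun y => curvGapX C u y t)
      (3 * uXX u x t ^ 3 * tilt u x t ^ 5 + C * uXX u x t ^ 2 * tilt u x t ^ 3 * (u x t)⁻¹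
        + C * uXX u x t * tilt u x t * (u x t)⁻¹ ^ 2
        + 9 * uX u x t * uXX u x t * uX (uXX u) x t * tilt u x t ^ 5
        + C * uX u x t * uX (uXX u) x t * tilt u x t ^ 3 * (u x t)⁻¹
        - uX (uX (uXX u)) x t * tilt u x t ^ 3
        - 15 * uX u x t ^ 2 * uXX u x t ^ 3 * tilt u x t ^ 7
        - 3 * C * uX u x t ^ 2 * uXX u x t ^ 2 * tilt u x t ^ 5 * (u x t)⁻¹
        - 2 * C * uX u x t ^ 2 * uXX u x t * tilt u x t ^ 3 * (u x t)⁻¹ ^ 2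
        - 2 * C * uX u x t ^ 2 * tilt u x t * (u x t)⁻¹ ^ 3) x := by
  have hp := h.hasDerivAt_uX hx
  have hq := h.hasDerivAt_uXX hx
  have hs := h.hasDerivAt_tilt hx
  have hw := h.hasDerivAt_inv_u hx
  refine (((((h.hasDerivAt_uXXX hx).mul (hs.pow 3)).neg.add
    (((hp.const_mul 3).mul (hq.pow 2)).mul (hs.pow 5))).add
    ((((hp.const_mul C).mul hq).mul (hs.pow 3)).mul hw)).add
    (((hp.const_mul C).mul hs).mul (hw.pow 2))).congr_deriv ?_
  simp only [Pi.pow_apply, Pi.mul_apply, Nat.cast_ofNat]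
  ring

/-- The evolution equation of `curvGap`. -/
theorem hasDerivAt_curvGap_time (h : ConvexFlow N tb K x₀ u)
    (C : ℝ) {x t G'' : ℝ} (hx : flowDomain tb x₀ ∈ 𝓝 (x, t))
    (hG : HasDerivAt (fun y => curvGapX C u y t) G'' x) :
    HasDerivAt (fun s => curvGap C u x s)
      (tilt u x t ^ 2 * G''
        + ((uXX u x t * tilt u x t ^ 3) ^ 2 + N * (tilt u x t * (u x t)⁻¹) ^ 2) * curvGap C u x t
        - 2 * (N + C) * (uX u x t * tilt u x t * (u x t)⁻¹) ^ 2 * curvGap 1 u x t) t := by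
  have hxd := mem_of_mem_nhds hx
  have hs := h.hasDerivAt_tilt_time hx
  rw [hG.unique (h.hasDerivAt_curvGapX C hxd)]
  refine (((h.hasDerivAt_uXX_time hx).mul (hs.pow 3)).neg.sub
    ((hs.mul (h.hasDerivAt_inv_u_time hxd)).const_mul C)).congr_deriv ?_
  simp only [curvGap, Pi.pow_apply, Nat.cast_ofNat]
  linear_combination (uXX u x t ^ 3 * tilt u x t ^ 7
    + N * uXX u x t * tilt u x t ^ 3 * (u x t)⁻¹ ^ 2
    + C * uXX u x t ^ 2 * tilt u x t ^ 5 * (u x t)⁻¹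
    + N * C * tilt u x t * (u x t)⁻¹ ^ 3) * tilt_sq_mul u x t

theorem curvGap_le (h : ConvexFlow N tb K x₀ u)
    {C : ℝ} (hC : 0 ≤ C) {x t : ℝ} (hx : (x, t) ∈ flowDomain tb x₀) :
    curvGap C u x t ≤ K := by
  have h1 := h.axial_curv_le hx
  have h2 := mul_nonneg hC (mul_pos (tilt_pos u x t) (inv_pos.2 (h.pos hx))).le
  unfold curvGap
  linarith

theorem continuousOn_inv_u (h : ConvexFlow N tb K x₀ u) :
    ContinuousOn (Function.uncurry fun x t => (u x t)⁻¹) (flowDomain tb x₀) :=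
  h.smooth.continuousOn.inv₀ fun _ hz => (h.pos hz).ne'

theorem continuousOn_curvGap (h : ConvexFlow N tb K x₀ u) (C : ℝ) :
    ContinuousOn (Function.uncurry (curvGap C u)) (flowDomain tb x₀) :=
  (h.smooth_uXX.continuousOn.mul (h.continuousOn_tilt.pow 3)).neg.sub
    (continuousOn_const.mul (h.continuousOn_tilt.mul h.continuousOn_inv_u))

theorem hasDerivAt_gapBarrier (h : ConvexFlow N tb K x₀ u)
    (C L ε m : ℝ) {x t : ℝ} (hx : (x, t) ∈ flowDomain tb x₀) :
    HasDerivAt (fun y => gapBarrier C L ε m u y t)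
      (Real.exp (-(L * t)) * curvGapX C u x t
        - ε * (-(uX u x t * (u x t)⁻¹ ^ 2) + 1)) x :=
  ((h.hasDerivAt_curvGap C hx).const_mul _).sub
    (((h.hasDerivAt_inv_u hx).add (((hasDerivAt_id x).sub_const m).add_const 1)).const_mul ε)

/-- At a positive spatial maximum, the barrier is strictly decreasing in time. -/
theorem exists_hasDerivAt_gapBarrier_neg (h : ConvexFlow N tb K x₀ u)
    {C ε m : ℝ} (hC : 1 ≤ C) (hε : 0 < ε) {x t : ℝ}
    (hx : flowDomain tb x₀ ∈ 𝓝 (x, t)) (hm : m ≤ x)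
    (hpos : 0 < gapBarrier C ((N + 1) * K ^ 2 + 1) ε m u x t)
    (hmax : IsLocalMax (fun y => gapBarrier C ((N + 1) * K ^ 2 + 1) ε m u y t) x) :
    ∃ d < 0, HasDerivAt (fun s => gapBarrier C ((N + 1) * K ^ 2 + 1) ε m u x s) d t := by
  have hxd := mem_of_mem_nhds hx
  set L := (N + 1) * K ^ 2 + 1 with hL
  obtain ⟨G'', hG⟩ : ∃ G'', HasDerivAt (fun y => curvGapX C u y t) G'' x :=
    ⟨_, h.hasDerivAt_curvGapX C hxd⟩
  have hGt := h.hasDerivAt_curvGap_time C hx hG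
  have hxx := hmax.second_deriv_nonpos
    ((eventually_slice hxd).mono fun y hy => h.hasDerivAt_gapBarrier C L ε m hy)
    ((hG.const_mul _).sub (((h.hasDerivAt_inv_uX hxd).add_const 1).const_mul ε))
  have hexp : HasDerivAt (fun s : ℝ => Real.exp (-(L * s))) (Real.exp (-(L * t)) * -L) t := by
    simpa using (((hasDerivAt_id t).const_mul L).neg).exp
  refine ⟨_, ?_, (hexp.mul hGt).sub
    (((h.hasDerivAt_inv_u_time hxd).add_const (x - m + 1)).const_mul ε)⟩
  unfold gapBarrier at hpos
  have he := Real.exp_pos (-(L * t))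
  have hw := inv_pos.2 (h.pos hxd)
  have hs := tilt_pos u x t
  have hN := h.one_le
  have ha := h.axial_curv_le hxd
  have hb := h.radial_curv_le hxd
  have hq := h.uXX_neg hxd
  have hG1 : curvGap C u x t ≤ curvGap 1 u x t := by
    unfold curvGap
    linarith [mul_le_mul_of_nonneg_right hC (mul_pos hs hw).le]
  generalize Real.exp (-(L * t)) = e at *
  generalize (u x t)⁻¹ = w at *
  have hb0 := mul_pos hs hw
  have ha0 : 0 < -uXX u x t * tilt u x t ^ 3 := mul_pos (neg_pos.2 hq) (pow_pos hs 3)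
  have heG : ε * w < e * curvGap C u x t := by nlinarith
  have hG0 : 0 < curvGap C u x t := pos_of_mul_pos_right ((mul_pos hε hw).trans heG) he.le
  generalize curvGap C u x t = G at *
  generalize curvGap 1 u x t = G₁ at *
  have hA : (uXX u x t * tilt u x t ^ 3) ^ 2 + N * (tilt u x t * w) ^ 2 - L < 0 := by
    have h1 : (-uXX u x t * tilt u x t ^ 3) ^ 2 ≤ K ^ 2 := by gcongr
    have h2 : (tilt u x t * w) ^ 2 ≤ K ^ 2 := by gcongr
    nlinarith
  have h1 := mul_neg_of_pos_of_neg (mul_pos he hG0) hA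
  have h2 : (uX u x t * tilt u x t * w) ^ 2 * (ε * w) ≤
      (uX u x t * tilt u x t * w) ^ 2 * (e * G₁) :=
    mul_le_mul_of_nonneg_left (heG.le.trans (mul_le_mul_of_nonneg_left hG1 he.le)) (sq_nonneg _)
  have h3 : (uX u x t * tilt u x t * w) ^ 2 * (e * G₁) ≤
      (N + C) * ((uX u x t * tilt u x t * w) ^ 2 * (e * G₁)) :=
    le_mul_of_one_le_left (mul_nonneg (sq_nonneg _) (mul_pos he (hG0.trans_le hG1)).le)
      (by linarith)
  have h4 := mul_nonpos_of_nonneg_of_nonpos (sq_nonneg (tilt u x t)) hxx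
  have h5 : 0 < ε * N * w ^ 3 := by positivity
  linarith

theorem curvGap_nonpos_of_lt (h : ConvexFlow N tb K x₀ u) {C : ℝ} (hC : 1 ≤ C)
    (hinit : ∀ x, x₀ 0 < x → curvGap C u x 0 ≤ 0) {x₁ t₁ : ℝ} (ht₁ : t₁ < tb)
    (hx₁ : (x₁, t₁) ∈ flowDomain tb x₀) : curvGap C u x₁ t₁ ≤ 0 := by
  by_contra! hpos
  have hK := h.curv_bound_pos hx₁
  obtain ⟨m, hm⟩ := h.lowerSemicontinuousOn_tip.bddBelow_of_isCompact isCompact_Icc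
  have hm : ∀ {z}, z ∈ flowDomain tb x₀ → m < z.1 := fun hz =>
    (hm (mem_image_of_mem x₀ hz.1)).trans_lt hz.2
  set L := (N + 1) * K ^ 2 + 1 with hL
  have hL0 : 0 < L := by
    have := h.one_le
    positivity
  set B := (u x₁ t₁)⁻¹ + (x₁ - m + 1) with hB
  have hB0 : 0 < B := by
    have h1 := inv_pos.2 (h.pos hx₁)
    have h2 := hm hx₁
    simp only at h2
    linarith
  set ε := Real.exp (-(L * t₁)) * curvGap C u x₁ t₁ / (2 * B) with hεdef
  have hε : 0 < ε := by positivity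
  have hΦ₁ : 0 < gapBarrier C L ε m u x₁ t₁ := by
    have h1 : ε * B = Real.exp (-(L * t₁)) * curvGap C u x₁ t₁ / 2 := by
      rw [hεdef]; field_simp
    have h2 : 0 < Real.exp (-(L * t₁)) * curvGap C u x₁ t₁ := by positivity
    unfold gapBarrier
    rw [← hB, h1]
    linarith
  set S : Set (ℝ × ℝ) := {z | z ∈ flowDomain tb x₀ ∧ ε / K ≤ u z.1 z.2} ∩
    Icc m (K / ε + m) ×ˢ Icc 0 t₁ with hS
  have hScompact : IsCompact S :=
    (isCompact_Icc.prod isCompact_Icc).inter_left (h.isClosed_superlevel (by positivity))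
  have hmemS : ∀ {z : ℝ × ℝ}, z ∈ flowDomain tb x₀ → z.2 ≤ t₁ →
      0 < gapBarrier C L ε m u z.1 z.2 → z ∈ S := by
    rintro ⟨x, t⟩ hz hzt hzpos
    have hw := inv_pos.2 (h.pos hz)
    have hmx := hm hz
    have h1 : Real.exp (-(L * t)) * curvGap C u x t ≤ K := by
      have he : Real.exp (-(L * t)) ≤ 1 :=
        Real.exp_le_one_iff.2 (neg_nonpos.2 (mul_nonneg hL0.le hz.1.1))
      calc _ ≤ Real.exp (-(L * t)) * K := by
            gcongr
            exact h.curvGap_le (zero_le_one.trans hC) hz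
        _ ≤ 1 * K := by gcongr
        _ = K := one_mul K
    simp only at hw hmx hzt
    have h2 : ε * ((u x t)⁻¹ + (x - m + 1)) < K := by
      unfold gapBarrier at hzpos
      linarith
    refine ⟨⟨hz, ?_⟩, ⟨hmx.le, ?_⟩, hz.1.1, hzt⟩
    · have h3 : ε * (u x t)⁻¹ ≤ K := by nlinarith
      rw [← div_eq_mul_inv, div_le_iff₀ (h.pos hz)] at h3
      rw [div_le_iff₀ hK]
      linarith
    · have h3 : (x - m) * ε ≤ K := by nlinarith
      have := (le_div_iff₀ hε).2 h3
      linarith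
  have hcont : ContinuousOn (Function.uncurry (gapBarrier C L ε m u)) S := by
    refine ContinuousOn.mono ?_ fun z hz => hz.1.1
    exact ((by fun_prop : Continuous fun z : ℝ × ℝ => Real.exp (-(L * z.2))).continuousOn.mul
      (h.continuousOn_curvGap C)).sub (continuousOn_const.mul (h.continuousOn_inv_u.add
        (by fun_prop : Continuous fun z : ℝ × ℝ => z.1 - m + 1).continuousOn))
  have hS₁ := hmemS hx₁ le_rfl hΦ₁
  obtain ⟨⟨x, t⟩, hxS, hmaxS⟩ := hScompact.exists_isMaxOn ⟨_, hS₁⟩ hcont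
  have hpos' : 0 < gapBarrier C L ε m u x t := hΦ₁.trans_le (hmaxS hS₁)
  have hmax : ∀ {z : ℝ × ℝ}, z ∈ flowDomain tb x₀ → z.2 ≤ t₁ →
      gapBarrier C L ε m u z.1 z.2 ≤ gapBarrier C L ε m u x t := fun {z} hz hzt => by
    rcases le_or_gt (gapBarrier C L ε m u z.1 z.2) 0 with h0 | h0
    · exact h0.trans hpos'.le
    · exact hmaxS (hmemS hz hzt h0)
  have hxd : (x, t) ∈ flowDomain tb x₀ := hxS.1.1
  have htt₁ : t ≤ t₁ := hxS.2.2.2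
  have ht0 : 0 < t := by
    refine lt_of_le_of_ne hxd.1.1 fun he => ?_
    subst he
    have h1 := hinit x hxd.2
    have h2 := inv_pos.2 (h.pos hxd)
    have h3 := hm hxd
    simp only at h3
    have h4 : 0 < ε * ((u x 0)⁻¹ + (x - m + 1)) := mul_pos hε (by linarith)
    have h5 := mul_nonpos_of_nonneg_of_nonpos (Real.exp_pos (-(L * 0))).le h1
    unfold gapBarrier at hpos'
    linarith
  have hnhds := flowDomain_mem_nhds ⟨ht0, htt₁.trans_lt ht₁⟩ hxd.2
    fun y hy => h.eventually_tip_lt hxd.1 hy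
  obtain ⟨d, hd, hder⟩ := h.exists_hasDerivAt_gapBarrier_neg hC hε hnhds (hm hxd).le hpos'
    ((eventually_slice hxd).mono fun y hy => hmax hy htt₁)
  have hslice : ∀ᶠ s in 𝓝[<] t, (x, s) ∈ flowDomain tb x₀ :=
    ((Continuous.prodMk_right x).continuousAt.eventually hnhds).filter_mono nhdsWithin_le_nhds
  obtain ⟨s, hs, hsd, hst⟩ :=
    ((hder.eventually_gt_nhdsLT hd).and (hslice.and self_mem_nhdsWithin)).exists
  exact absurd hs (not_lt.2 (hmax hsd ((le_of_lt hst).trans htt₁)))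

theorem curvGap_nonpos (h : ConvexFlow N tb K x₀ u) {C : ℝ} (hC : 1 ≤ C)
    (hinit : ∀ x, x₀ 0 < x → curvGap C u x 0 ≤ 0) {x t : ℝ}
    (hx : (x, t) ∈ flowDomain tb x₀) : curvGap C u x t ≤ 0 := by
  rcases hx.1.2.lt_or_eq with ht | rfl
  · exact h.curvGap_nonpos_of_lt hC hinit ht hx
  rcases hx.1.1.eq_or_lt with ht | ht
  · simp only at ht
    subst ht
    exact hinit x hx.2
  by_contra! hpos
  have hev := eventually_nhdsWithin_iff.1 ((ContinuousOn.continuousWithinAt_time_slice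
    (h.continuousOn_curvGap C) hx).eventually_const_lt hpos)
  have htip := eventually_nhdsWithin_iff.1 (h.eventually_tip_lt hx.1 hx.2)
  obtain ⟨s, ⟨hs, hst⟩, hsI⟩ := (((hev.and htip).filter_mono nhdsWithin_le_nhds).and
    (Ioo_mem_nhdsLT ht)).exists
  have hsd : (x, s) ∈ flowDomain _ x₀ := ⟨⟨hsI.1.le, hsI.2.le⟩, hst ⟨hsI.1.le, hsI.2.le⟩⟩
  exact absurd (hs hsd) (not_lt.2 (h.curvGap_nonpos_of_lt hC hinit hsI.2 hsd))

end ConvexFlow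

/-- For a complete noncompact strictly convex rotationally symmetric
graphical mean curvature flow `u(x,t)`, `x > x₀(t)`, `t ∈ [0, t̄]`, with uniformly bounded
second fundamental form and with the ratio `ℜ = −u·u_xx/(1+u_x²)` extending continuously to
the tip with value `1` there, the bound `ℜ ≤ C` (with `C ≥ 1`) at `t = 0` is preserved:
`ℜ ≤ C` for all `t ∈ [0, t̄]`. -/
theorem ratio_bound_preserved
    (n : ℕ) (hn : 2 ≤ n) (tb T C : ℝ) (htb : 0 ≤ tb) (htT : tb < T) (hC : 1 ≤ C)
    (x₀ : ℝ → ℝ) (u : ℝ → ℝ → ℝ)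
    (hsmooth : ContDiffOn ℝ (⊤ : ℕ∞) (Function.uncurry u)
      {p : ℝ × ℝ | p.2 ∈ Icc 0 tb ∧ x₀ p.2 < p.1})
    (hpos : ∀ x t : ℝ, t ∈ Icc 0 tb → x₀ t < x → 0 < u x t)
    (htip : ∀ t ∈ Icc 0 tb, u (x₀ t) t = 0)
    (htipcont : ∀ t ∈ Icc 0 tb, Tendsto (fun x => u x t) (𝓝[>] (x₀ t)) (𝓝 0))
    (hux : ∀ x t : ℝ, t ∈ Icc 0 tb → x₀ t < x → 0 < uX u x t)
    (huxx : ∀ x t : ℝ, t ∈ Icc 0 tb → x₀ t < x → uXX u x t < 0)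
    (hPDE : ∀ x t : ℝ, t ∈ Icc 0 tb → x₀ t < x →
      uT u x t = uXX u x t / (1 + (uX u x t) ^ 2) - ((n : ℝ) - 1) / u x t)
    (hcurvbound : ∃ K : ℝ, ∀ x t : ℝ, t ∈ Icc 0 tb → x₀ t < x →
      1 / (u x t * Real.sqrt (1 + (uX u x t) ^ 2)) ≤ K ∧
      -uXX u x t / (1 + (uX u x t) ^ 2) ^ ((3 : ℝ) / 2) ≤ K)
    (hRtip : ∀ t ∈ Icc 0 tb, Tendsto (fun x => ratioR u x t) (𝓝[>] (x₀ t)) (𝓝 1))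
    (hinit : ∀ x : ℝ, x₀ 0 < x → ratioR u x 0 ≤ C) :
    ∀ x t : ℝ, t ∈ Icc 0 tb → x₀ t < x → ratioR u x t ≤ C := by
  obtain ⟨K, hK⟩ := hcurvbound
  have hflow : ConvexFlow ((n : ℝ) - 1) tb K x₀ u :=
    { one_le := by
        have : (2 : ℝ) ≤ n := by exact_mod_cast hn
        linarith
      smooth := hsmooth
      pos := fun hx => hpos _ _ hx.1 hx.2
      tip := fun {t} ht => htipcont t ht
      uX_pos := fun hx => hux _ _ hx.1 hx.2
      uXX_neg := fun hx => huxx _ _ hx.1 hx.2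
      pde := fun {x t} hx => by
        rw [hPDE x t hx.1 hx.2, div_eq_mul_inv, div_eq_mul_inv, ← tilt_sq]
      radial_curv_le := fun {x t} hx => by
        have := (hK x t hx.1 hx.2).1
        rwa [one_div, mul_inv, mul_comm] at this
      axial_curv_le := fun {x t} hx => by
        have := (hK x t hx.1 hx.2).2
        rwa [div_eq_mul_inv, ← tilt_pow_three] at this }
  intro x t ht hx
  refine (curvGap_nonpos_iff (hpos x t ht hx)).1
    (hflow.curvGap_nonpos hC (fun y hy => ?_) ⟨ht, hx⟩)
  have h0 : (0 : ℝ) ∈ Icc 0 tb := ⟨le_rfl, htb⟩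
  exact (curvGap_nonpos_iff (hpos y 0 h0 hy)).2 (hinit y hy)
end
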